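/- Let E = ℝ^d, let σ > 0 and r ≥ 2, and let φ : E → ℝ be differentiable and (σ,r)-uniformly convex with respect to the Euclidean norm. Let f_1, …, f_m : E → ℝ be convex, differentiable, and G_l-Lipschitz, and let F(w) = ∑_{i=1}^m f_i(w) attain its minimum at x*. Let (P(t))_{t≥0} be m×m doubly stochastic matrices satisfying the connectivity assumption with constants ζ > 0 and B ≥ 1, and set ϑ = (1 − ζ/(4m²))^{−2}, κ = (1 − ζ/(4m²))^{1/B}. Let η > 0 and let sequences w_{i,t}, y_{i,t}, w̄_t in E satisfy ∇φ(y_{i,t}) = ∑_{j=1}^m P(t)_{ij} ∇φ(w_{j,t}), ∇φ(w_{i,t+1}) = ∇φ(y_{i,t}) − η ∇f_i(w_{i,t}), and ∇φ(w̄_t) = (1/m) ∑_{i=1}^m ∇φ(w_{i,t}). Then for every T ≥ 1: min_{0 ≤ t < T} F(w̄_t) − F(x*) ≤ (2mG_l/T) ∑_{t=0}^{T−1} [ (ϑ/σ)( κ^{t−1} ∑_{j=1}^m ‖∇φ(w_{j,0})‖ + mηG_l/(1−κ) + 2ηG_l ) ]^{1/(r−1)} + m·((r−1)/r)·( η G_l^r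 / σ )^{1/(r−1)} + m·D_φ(x*, w̄_0)/(ηT). -/

import Mathlib

open RealInnerProductSpace

/-- A threshold `d` separating two points of a sorted configuration contributes its gap. -/
lemma sum_sq_gap_le_sq_sub {s : ℕ → ℝ} (hs : Monotone s) {D : Finset ℕ} {a b : ℝ}
    (ha : ∀ d ∈ D, a ≤ s d) (hb : ∀ d ∈ D, s (d + 1) ≤ b) :
    ∑ d ∈ D, (s (d + 1) - s d) ^ 2 ≤ (b - a) ^ 2 := by
  have hgap : ∀ d, 0 ≤ s (d + 1) - s d := fun d => sub_nonneg.2 (hs d.le_succ)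
  rcases D.eq_empty_or_nonempty with rfl | hD
  · simpa using sq_nonneg (b - a)
  have hsum : ∑ d ∈ D, (s (d + 1) - s d) ≤ b - a := by
    have hmin := ha _ (D.min'_mem hD)
    have hmax := hb _ (D.max'_mem hD)
    have hsub : D ⊆ Finset.Ico (D.min' hD) (D.max' hD + 1) := fun d hd =>
      Finset.mem_Ico.2 ⟨D.min'_le d hd, Nat.lt_succ_of_le (D.le_max' d hd)⟩
    calc ∑ d ∈ D, (s (d + 1) - s d)
        ≤ ∑ d ∈ Finset.Ico (D.min' hD) (D.max' hD + 1), (s (d + 1) - s d) :=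
          Finset.sum_le_sum_of_subset_of_nonneg hsub fun d _ _ => hgap d
      _ = s (D.max' hD + 1) - s (D.min' hD) :=
          Finset.sum_Ico_sub _ ((D.min'_le _ (D.max'_mem hD)).trans (Nat.le_succ _))
      _ ≤ b - a := by linarith
  calc ∑ d ∈ D, (s (d + 1) - s d) ^ 2 ≤ (∑ d ∈ D, (s (d + 1) - s d)) ^ 2 :=
        Finset.sum_sq_le_sq_sum_of_nonneg fun d _ => hgap d
    _ ≤ (b - a) ^ 2 := by
        gcongr
        exact Finset.sum_nonneg fun d _ => hgap d

/-- Variance of a weighted average as a double sum. -/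
lemma sum_mul_sq_sub_sq_sum {m : ℕ} {p x : Fin m → ℝ} (hp : ∑ j, p j = 1) :
    ∑ j, p j * x j ^ 2 - (∑ j, p j * x j) ^ 2
      = 1 / 2 * ∑ i, ∑ j, p i * p j * (x i - x j) ^ 2 := by
  have h : ∀ i, ∑ j, p i * p j * (x i - x j) ^ 2
      = p i * x i ^ 2 - 2 * (p i * x i) * (∑ j, p j * x j) + p i * ∑ j, p j * x j ^ 2 := by
    intro i
    have : p i * x i ^ 2 = p i * x i ^ 2 * ∑ j, p j := by rw [hp, mul_one]
    rw [this, Finset.mul_sum, Finset.mul_sum, Finset.mul_sum, ← Finset.sum_sub_distrib,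
      ← Finset.sum_add_distrib]
    exact Finset.sum_congr rfl fun j _ => by ring
  simp only [h, Finset.sum_add_distrib, Finset.sum_sub_distrib, ← Finset.sum_mul,
    ← Finset.mul_sum, hp]
  ring

/-- Lower bound for the variance of a weighted average by the squared gaps of the cuts. -/
lemma sum_gap_sq_mul_le_variance {m : ℕ} {p x : Fin m → ℝ} (hp0 : ∀ j, 0 ≤ p j)
    (hp : ∑ j, p j = 1) {s : ℕ → ℝ} (hs : Monotone s) (rk : Fin m → ℕ) (D : Finset ℕ)
    (hlo : ∀ d ∈ D, ∀ i, rk i ≤ d → x i ≤ s d)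
    (hhi : ∀ d ∈ D, ∀ i, d < rk i → s (d + 1) ≤ x i) :
    ∑ d ∈ D, (s (d + 1) - s d) ^ 2 *
        ((∑ i with rk i ≤ d, p i) * (1 - ∑ i with rk i ≤ d, p i))
      ≤ ∑ j, p j * x j ^ 2 - (∑ j, p j * x j) ^ 2 := by
  classical
  rw [sum_mul_sq_sub_sq_sum hp]
  have hpt : ∀ i j, ∑ d ∈ D, (s (d + 1) - s d) ^ 2 *
      ((if rk i ≤ d ∧ d < rk j then 1 else 0) + (if rk j ≤ d ∧ d < rk i then 1 else 0))
      ≤ (x i - x j) ^ 2 := by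
    intro i j
    rcases le_total (rk i) (rk j) with hij | hij
    · have : ∀ d ∈ D, (s (d + 1) - s d) ^ 2 *
          ((if rk i ≤ d ∧ d < rk j then 1 else 0) + (if rk j ≤ d ∧ d < rk i then 1 else 0))
          = if rk i ≤ d ∧ d < rk j then (s (d + 1) - s d) ^ 2 else 0 := by
        intro d _
        have : ¬ (rk j ≤ d ∧ d < rk i) := by omega
        simp [this]
      rw [Finset.sum_congr rfl this, ← Finset.sum_filter]
      have := sum_sq_gap_le_sq_sub hs (D := D.filter fun d => rk i ≤ d ∧ d < rk j)
        (a := x i) (b := x j) (fun d hd => ?_) (fun d hd => ?_)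
      · linarith [this, sq_nonneg (x i - x j), (by ring : (x j - x i) ^ 2 = (x i - x j) ^ 2)]
      · obtain ⟨h1, h2, h3⟩ := Finset.mem_filter.1 hd
        exact hlo d h1 i h2
      · obtain ⟨h1, h2, h3⟩ := Finset.mem_filter.1 hd
        exact hhi d h1 j h3
    · have : ∀ d ∈ D, (s (d + 1) - s d) ^ 2 *
          ((if rk i ≤ d ∧ d < rk j then 1 else 0) + (if rk j ≤ d ∧ d < rk i then 1 else 0))
          = if rk j ≤ d ∧ d < rk i then (s (d + 1) - s d) ^ 2 else 0 := by
        intro d _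
        have : ¬ (rk i ≤ d ∧ d < rk j) := by omega
        simp [this]
      rw [Finset.sum_congr rfl this, ← Finset.sum_filter]
      refine sum_sq_gap_le_sq_sub hs (fun d hd => ?_) (fun d hd => ?_)
      · obtain ⟨h1, h2, h3⟩ := Finset.mem_filter.1 hd
        exact hlo d h1 j h2
      · obtain ⟨h1, h2, h3⟩ := Finset.mem_filter.1 hd
        exact hhi d h1 i h3
  have hprod : ∀ d, ∑ i, ∑ j, p i * p j *
      ((if rk i ≤ d ∧ d < rk j then (1 : ℝ) else 0) + (if rk j ≤ d ∧ d < rk i then 1 else 0))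
      = 2 * ((∑ i with rk i ≤ d, p i) * (1 - ∑ i with rk i ≤ d, p i)) := by
    intro d
    have hc : 1 - ∑ i with rk i ≤ d, p i = ∑ i with d < rk i, p i := by
      rw [← hp, ← Finset.sum_filter_add_sum_filter_not Finset.univ (fun i => rk i ≤ d)]
      simp only [not_le]
      ring
    have h1 : ∑ i, ∑ j, p i * p j * (if rk i ≤ d ∧ d < rk j then (1 : ℝ) else 0)
        = (∑ i with rk i ≤ d, p i) * ∑ i with d < rk i, p i := by
      rw [Finset.sum_mul_sum, Finset.sum_filter]
      refine Finset.sum_congr rfl fun i _ => ?_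
      rw [Finset.sum_filter]
      split_ifs with h
      · exact Finset.sum_congr rfl fun j _ => by simp [h]
      · simp [h]
    have h2 : ∑ i, ∑ j, p i * p j * (if rk j ≤ d ∧ d < rk i then (1 : ℝ) else 0)
        = (∑ i with rk i ≤ d, p i) * ∑ i with d < rk i, p i := by
      rw [← h1, Finset.sum_comm]
      exact Finset.sum_congr rfl fun i _ => Finset.sum_congr rfl fun j _ => by ring
    simp only [mul_add, Finset.sum_add_distrib, h1, h2, hc]
    ring
  calc _ = 1 / 2 * ∑ d ∈ D, (s (d + 1) - s d) ^ 2 * ∑ i, ∑ j, p i * p j *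
        ((if rk i ≤ d ∧ d < rk j then (1 : ℝ) else 0)
          + (if rk j ≤ d ∧ d < rk i then 1 else 0)) := by
        rw [Finset.mul_sum]
        exact Finset.sum_congr rfl fun d _ => by rw [hprod]; ring
    _ = 1 / 2 * ∑ i, ∑ j, p i * p j * ∑ d ∈ D, (s (d + 1) - s d) ^ 2 *
        ((if rk i ≤ d ∧ d < rk j then (1 : ℝ) else 0)
          + (if rk j ≤ d ∧ d < rk i then 1 else 0)) := by
        congr 1
        simp only [Finset.mul_sum]
        rw [Finset.sum_comm]
        refine Finset.sum_congr rfl fun i _ => ?_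
        rw [Finset.sum_comm]
        exact Finset.sum_congr rfl fun j _ => Finset.sum_congr rfl fun d _ => by ring
    _ ≤ _ := by
        gcongr with i _ j _
        · exact mul_nonneg (hp0 i) (hp0 j)
        · exact hpt i j

/-- One averaging step crossing each of the cuts in `D` decreases the energy. -/
lemma energy_decrease {m : ℕ} {P : Matrix (Fin m) (Fin m) ℝ} {ζ : ℝ}
    (hnonneg : ∀ i j, 0 ≤ P i j) (hrow : ∀ i, ∑ j, P i j = 1) (hcol : ∀ j, ∑ i, P i j = 1)
    (hζ : 0 < ζ) (hζ2 : ζ ≤ 1 / 2) (hdiag : ∀ i, ζ ≤ P i i)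
    (hedge : ∀ i j : Fin m, i ≠ j → (0 < P i j ∨ 0 < P j i) → ζ ≤ P i j)
    (x : Fin m → ℝ) {s : ℕ → ℝ} (hs : Monotone s) (rk : Fin m → ℕ) (D : Finset ℕ)
    (hlo : ∀ d ∈ D, ∀ i, rk i ≤ d → x i ≤ s d)
    (hhi : ∀ d ∈ D, ∀ i, d < rk i → s (d + 1) ≤ x i)
    (hcross : ∀ d ∈ D, ∃ a b, rk a ≤ d ∧ d < rk b ∧ (0 < P a b ∨ 0 < P b a)) :
    ∑ i, (∑ j, P i j * x j) ^ 2 + ζ * ∑ d ∈ D, (s (d + 1) - s d) ^ 2 ≤ ∑ i, x i ^ 2 := by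
  classical
  have hsum : ∑ i, x i ^ 2 = ∑ i, ∑ j, P i j * x j ^ 2 := by
    rw [Finset.sum_comm]
    exact Finset.sum_congr rfl fun j _ => by rw [← Finset.sum_mul, hcol, one_mul]
  have hq0 : ∀ i d, 0 ≤ ∑ j with rk j ≤ d, P i j := fun i d =>
    Finset.sum_nonneg fun j _ => hnonneg i j
  have hqc : ∀ i d, 1 - ∑ j with rk j ≤ d, P i j = ∑ j with d < rk j, P i j := by
    intro i d
    rw [← hrow i, ← Finset.sum_filter_add_sum_filter_not Finset.univ (fun j => rk j ≤ d)]
    simp only [not_le]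
    ring
  have hq1 : ∀ i d, 0 ≤ 1 - ∑ j with rk j ≤ d, P i j := fun i d => by
    rw [hqc]; exact Finset.sum_nonneg fun j _ => hnonneg i j
  have hcut : ∀ d ∈ D, ζ ≤ ∑ i, (∑ j with rk j ≤ d, P i j) * (1 - ∑ j with rk j ≤ d, P i j) := by
    intro d hd
    obtain ⟨a, b, ha, hb, hab⟩ := hcross d hd
    have hne : a ≠ b := by rintro rfl; omega
    have hprod : ∀ i c c', rk c ≤ d → d < rk c' → ζ ≤ P i c → ζ ≤ P i c' →
        ζ / 2 ≤ (∑ j with rk j ≤ d, P i j) * (1 - ∑ j with rk j ≤ d, P i j) := by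
      intro i c c' hc hc' h1 h2
      have e1 : ζ ≤ ∑ j with rk j ≤ d, P i j :=
        h1.trans (Finset.single_le_sum (f := fun j => P i j) (fun j _ => hnonneg i j)
          (Finset.mem_filter.2 ⟨Finset.mem_univ c, hc⟩))
      have e2 : ζ ≤ 1 - ∑ j with rk j ≤ d, P i j := by
        rw [hqc]
        exact h2.trans (Finset.single_le_sum (f := fun j => P i j) (fun j _ => hnonneg i j)
          (Finset.mem_filter.2 ⟨Finset.mem_univ c', hc'⟩))
      nlinarith [mul_nonneg (sub_nonneg.2 e1) (sub_nonneg.2 e2)]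
    have h1 := hprod a a b ha hb (hdiag a) (hedge a b hne hab)
    have h2 := hprod b a b ha hb (hedge b a hne.symm hab.symm) (hdiag b)
    have hsub := Finset.sum_le_sum_of_subset_of_nonneg (Finset.subset_univ ({a, b} : Finset (Fin m)))
      (f := fun i => (∑ j with rk j ≤ d, P i j) * (1 - ∑ j with rk j ≤ d, P i j))
      fun i _ _ => mul_nonneg (hq0 i d) (hq1 i d)
    rw [Finset.sum_pair hne] at hsub
    linarith
  have hvar : ∑ i, ∑ d ∈ D, (s (d + 1) - s d) ^ 2 *
      ((∑ j with rk j ≤ d, P i j) * (1 - ∑ j with rk j ≤ d, P i j))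
      ≤ ∑ i, (∑ j, P i j * x j ^ 2 - (∑ j, P i j * x j) ^ 2) :=
    Finset.sum_le_sum fun i _ =>
      sum_gap_sq_mul_le_variance (hnonneg i) (hrow i) hs rk D hlo hhi
  have hlow : ζ * ∑ d ∈ D, (s (d + 1) - s d) ^ 2 ≤ ∑ i, ∑ d ∈ D, (s (d + 1) - s d) ^ 2 *
      ((∑ j with rk j ≤ d, P i j) * (1 - ∑ j with rk j ≤ d, P i j)) := by
    rw [Finset.sum_comm, Finset.mul_sum]
    refine Finset.sum_le_sum fun d hd => ?_
    rw [← Finset.mul_sum, mul_comm]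
    exact mul_le_mul_of_nonneg_left (hcut d hd) (sq_nonneg _)
  rw [Finset.sum_sub_distrib, ← hsum] at hvar
  linarith

/-- Contraction of the energy of a mean-zero configuration over a connected block. -/
lemma energy_block_contraction {m B : ℕ} (hm : 2 ≤ m) {P : ℕ → Matrix (Fin m) (Fin m) ℝ} {ζ : ℝ}
    (hnonneg : ∀ t, ∀ i j, 0 ≤ P t i j) (hrow : ∀ t, ∀ i, ∑ j, P t i j = 1)
    (hcol : ∀ t, ∀ j, ∑ i, P t i j = 1)
    (hζ : 0 < ζ) (hζ2 : ζ ≤ 1 / 2) (hdiag : ∀ t, ∀ i, ζ ≤ P t i i)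
    (hedge : ∀ t, ∀ i j : Fin m, i ≠ j → (0 < P t i j ∨ 0 < P t j i) → ζ ≤ P t i j)
    (hconn : ∀ i j : Fin m,
      Relation.ReflTransGen (fun a b => a ≠ b ∧ ∃ t < B, (0 < P t a b ∨ 0 < P t b a)) i j)
    (x : ℕ → Fin m → ℝ) (hx : ∀ t i, x (t + 1) i = ∑ j, P t i j * x t j)
    (hmean : ∑ i, x 0 i = 0) :
    ∑ i, x B i ^ 2 ≤ (1 - 4 * ζ / (m : ℝ) ^ 2) * ∑ i, x 0 i ^ 2 := by
  classical
  set σ := Tuple.sort (x 0) with hσ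
  have hmono : Monotone (x 0 ∘ σ) := Tuple.monotone_sort (x 0)
  have hlt : ∀ k, min k (m - 1) < m := fun k => by omega
  set s : ℕ → ℝ := fun k => x 0 (σ ⟨min k (m - 1), hlt k⟩) with hs_def
  have hs : Monotone s := fun a b hab => hmono (by
    simp only [Fin.mk_le_mk]; omega)
  set rk : Fin m → ℕ := fun i => (σ.symm i : ℕ) with hrk
  have hrk_lt : ∀ i, rk i < m := fun i => (σ.symm i).2
  have hx0 : ∀ i, x 0 i = s (rk i) := by
    intro i
    have : (⟨min (rk i) (m - 1), hlt (rk i)⟩ : Fin m) = σ.symm i := by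
      ext
      have := hrk_lt i
      simp only [hrk] at this ⊢
      omega
    simp only [hs_def, this, Equiv.apply_symm_apply]
  let crossed : ℕ → ℕ → Prop := fun t d =>
    ∃ a b, rk a ≤ d ∧ d < rk b ∧ (0 < P t a b ∨ 0 < P t b a)
  have hinv : ∀ t d, (∀ u < t, ¬ crossed u d) →
      (∀ i, rk i ≤ d → x t i ≤ s d) ∧ (∀ i, d < rk i → s (d + 1) ≤ x t i) := by
    intro t d
    induction t with
    | zero =>
      intro _
      exact ⟨fun i hi => by rw [hx0]; exact hs hi, fun i hi => by rw [hx0]; exact hs hi⟩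
    | succ t ih =>
      intro hnc
      obtain ⟨h1, h2⟩ := ih fun u hu => hnc u (hu.trans t.lt_succ_self)
      have hno := hnc t t.lt_succ_self
      constructor
      · intro i hi
        rw [hx]
        calc ∑ j, P t i j * x t j ≤ ∑ j, P t i j * s d := by
              refine Finset.sum_le_sum fun j _ => ?_
              by_cases hj : rk j ≤ d
              · exact mul_le_mul_of_nonneg_left (h1 j hj) (hnonneg t i j)
              · have : P t i j = 0 := by
                  by_contra h
                  exact hno ⟨i, j, hi, not_le.1 hj,
                    Or.inl (lt_of_le_of_ne (hnonneg t i j) (Ne.symm h))⟩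
                simp [this]
          _ = s d := by rw [← Finset.sum_mul, hrow, one_mul]
      · intro i hi
        rw [hx]
        calc s (d + 1) = ∑ j, P t i j * s (d + 1) := by rw [← Finset.sum_mul, hrow, one_mul]
          _ ≤ ∑ j, P t i j * x t j := by
              refine Finset.sum_le_sum fun j _ => ?_
              by_cases hj : rk j ≤ d
              · have : P t i j = 0 := by
                  by_contra h
                  exact hno ⟨j, i, hj, hi,
                    Or.inr (lt_of_le_of_ne (hnonneg t i j) (Ne.symm h))⟩
                simp [this]
              · exact mul_le_mul_of_nonneg_left (h2 j (not_le.1 hj)) (hnonneg t i j)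
  let first : ℕ → Finset ℕ := fun t =>
    (Finset.range (m - 1)).filter fun d => crossed t d ∧ ∀ u < t, ¬ crossed u d
  have hstep : ∀ t, ∑ i, x (t + 1) i ^ 2 + ζ * ∑ d ∈ first t, (s (d + 1) - s d) ^ 2
      ≤ ∑ i, x t i ^ 2 := by
    intro t
    have := energy_decrease (hnonneg t) (hrow t) (hcol t) hζ hζ2 (hdiag t) (hedge t) (x t) hs rk
      (first t) (fun d hd => (hinv t d (Finset.mem_filter.1 hd).2.2).1)
      (fun d hd => (hinv t d (Finset.mem_filter.1 hd).2.2).2)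
      (fun d hd => (Finset.mem_filter.1 hd).2.1)
    simpa only [hx] using this
  have hsum : ∀ n, ∑ i, x n i ^ 2
      + ζ * ∑ t ∈ Finset.range n, ∑ d ∈ first t, (s (d + 1) - s d) ^ 2 ≤ ∑ i, x 0 i ^ 2 := by
    intro n
    induction n with
    | zero => simp
    | succ n ih =>
      rw [Finset.sum_range_succ, mul_add]
      linarith [hstep n]
  have hcover : ∀ d ∈ Finset.range (m - 1), ∃ t < B, crossed t d ∧ ∀ u < t, ¬ crossed u d := by
    intro d hd
    have hd' : d < m - 1 := Finset.mem_range.1 hd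
    have hex : ∃ t, t < B ∧ crossed t d := by
      by_contra hcon
      push Not at hcon
      have key : ∀ i j, Relation.ReflTransGen
          (fun a b => a ≠ b ∧ ∃ t < B, (0 < P t a b ∨ 0 < P t b a)) i j → rk i ≤ d → rk j ≤ d := by
        intro i j hij hi
        induction hij with
        | refl => exact hi
        | tail _ hbc ih =>
          obtain ⟨_, t, ht, hP⟩ := hbc
          by_contra hc
          exact hcon t ht ⟨_, _, ih, not_le.1 hc, hP⟩
      have h0 : rk (σ ⟨0, by omega⟩) = 0 := by simp [hrk]
      have h1 : rk (σ ⟨m - 1, by omega⟩) = m - 1 := by simp [hrk]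
      have := key _ _ (hconn (σ ⟨0, by omega⟩) (σ ⟨m - 1, by omega⟩)) (by omega)
      omega
    refine ⟨Nat.find hex, (Nat.find_spec hex).1, (Nat.find_spec hex).2, fun u hu hc => ?_⟩
    exact Nat.find_min hex hu ⟨hu.trans (Nat.find_spec hex).1, hc⟩
  have hgaps : ∑ d ∈ Finset.range (m - 1), (s (d + 1) - s d) ^ 2
      ≤ ∑ t ∈ Finset.range B, ∑ d ∈ first t, (s (d + 1) - s d) ^ 2 := by
    have hsub : Finset.range (m - 1) ⊆ (Finset.range B).biUnion first := by
      intro d hd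
      obtain ⟨t, ht, h1, h2⟩ := hcover d hd
      exact Finset.mem_biUnion.2 ⟨t, Finset.mem_range.2 ht, Finset.mem_filter.2 ⟨hd, h1, h2⟩⟩
    refine (Finset.sum_le_sum_of_subset_of_nonneg hsub fun _ _ _ => sq_nonneg _).trans ?_
    rw [Finset.sum_biUnion]
    intro t _ u _ htu
    refine Finset.disjoint_left.2 fun d hd hd' => ?_
    obtain ⟨-, h1, h2⟩ := Finset.mem_filter.1 hd
    obtain ⟨-, h3, h4⟩ := Finset.mem_filter.1 hd'
    rcases lt_or_gt_of_ne htu with h | h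
    · exact h4 t h h1
    · exact h2 u h h3
  have hrange : (s (m - 1) - s 0) ^ 2
      ≤ ((m : ℝ) - 1) * ∑ d ∈ Finset.range (m - 1), (s (d + 1) - s d) ^ 2 := by
    have := sq_sum_le_card_mul_sum_sq (s := Finset.range (m - 1)) (f := fun d => s (d + 1) - s d)
    rw [Finset.sum_range_sub, Finset.card_range, Nat.cast_sub (by omega)] at this
    simpa using this
  have hpop : ∑ i, x 0 i ^ 2 ≤ m * (s (m - 1) - s 0) ^ 2 / 4 := by
    have h1 : ∀ i, 0 ≤ (x 0 i - s 0) * (s (m - 1) - x 0 i) := fun i => by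
      rw [hx0 i]
      exact mul_nonneg (sub_nonneg.2 (hs (Nat.zero_le _)))
        (sub_nonneg.2 (hs (by have := hrk_lt i; omega)))
    have h2 : ∑ i, (x 0 i - s 0) * (s (m - 1) - x 0 i)
        = (s 0 + s (m - 1)) * ∑ i, x 0 i - ∑ i, x 0 i ^ 2 - m * (s 0 * s (m - 1)) := by
      have : (m : ℝ) * (s 0 * s (m - 1)) = ∑ _i : Fin m, s 0 * s (m - 1) := by simp
      rw [this, Finset.mul_sum, ← Finset.sum_sub_distrib, ← Finset.sum_sub_distrib]
      exact Finset.sum_congr rfl fun i _ => by ring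
    have h3 := Finset.sum_nonneg fun i (_ : i ∈ Finset.univ) => h1 i
    rw [h2, hmean] at h3
    have hm0 : (0 : ℝ) ≤ m := Nat.cast_nonneg m
    nlinarith [mul_nonneg hm0 (sq_nonneg (s 0 + s (m - 1)))]
  have hm2 : (2 : ℝ) ≤ m := by exact_mod_cast hm
  set Γ := ∑ d ∈ Finset.range (m - 1), (s (d + 1) - s d) ^ 2 with hΓ
  have hΓ0 : 0 ≤ Γ := Finset.sum_nonneg fun _ _ => sq_nonneg _
  have hV : ∑ i, x 0 i ^ 2 ≤ (m : ℝ) ^ 2 / 4 * Γ := by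
    nlinarith
  have hfin := hsum B
  have h4 : 4 * ζ / (m : ℝ) ^ 2 * ∑ i, x 0 i ^ 2 ≤ ζ * Γ := by
    calc 4 * ζ / (m : ℝ) ^ 2 * ∑ i, x 0 i ^ 2 ≤ 4 * ζ / (m : ℝ) ^ 2 * ((m : ℝ) ^ 2 / 4 * Γ) := by
          gcongr
      _ = ζ * Γ := by field_simp
  nlinarith [mul_le_mul_of_nonneg_left hgaps hζ.le]

/-- The Euclidean distance of a family of vectors from consensus. -/
noncomputable def deviation {m : ℕ} {V : Type*} [NormedAddCommGroup V] [InnerProductSpace ℝ V]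
    (z : Fin m → V) : ℝ :=
  ‖(WithLp.toLp 2 (fun i => z i - (1 / (m : ℝ)) • ∑ j, z j) : PiLp 2 fun _ : Fin m => V)‖

section Deviation

variable {m : ℕ} {V : Type*} [NormedAddCommGroup V] [InnerProductSpace ℝ V]

lemma deviation_nonneg (z : Fin m → V) : 0 ≤ deviation z := norm_nonneg _

lemma deviation_sq (z : Fin m → V) :
    deviation z ^ 2 = ∑ i, ‖z i - (1 / (m : ℝ)) • ∑ j, z j‖ ^ 2 := by
  simp [deviation, PiLp.norm_sq_eq_of_L2]

lemma deviation_add_le (x y : Fin m → V) :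
    deviation (fun i => x i + y i) ≤ deviation x + deviation y := by
  refine le_trans (le_of_eq ?_) (norm_add_le _ _)
  rw [deviation, ← WithLp.toLp_add]
  congr 2
  ext i
  simp only [Pi.add_apply, Finset.sum_add_distrib, smul_add]
  abel

lemma norm_sub_mean_le_deviation (z : Fin m → V) (i : Fin m) :
    ‖z i - (1 / (m : ℝ)) • ∑ j, z j‖ ≤ deviation z :=
  PiLp.norm_apply_le (WithLp.toLp 2 fun i => z i - (1 / (m : ℝ)) • ∑ j, z j) i

lemma deviation_sq_le (hm : 1 ≤ m) (z : Fin m → V) : deviation z ^ 2 ≤ ∑ i, ‖z i‖ ^ 2 := by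
  have hm0 : (0 : ℝ) < m := by exact_mod_cast hm
  rw [deviation_sq]
  set c := (1 / (m : ℝ)) • ∑ j, z j with hc
  have hs : ∑ j, z j = (m : ℝ) • c := by
    rw [hc, smul_smul, mul_one_div_cancel hm0.ne', one_smul]
  have h : ∑ i, ‖z i - c‖ ^ 2 = ∑ i, ‖z i‖ ^ 2 - m * ‖c‖ ^ 2 := by
    simp only [norm_sub_sq_real, Finset.sum_add_distrib, Finset.sum_sub_distrib, ← Finset.mul_sum,
      ← sum_inner, hs, real_inner_smul_left, real_inner_self_eq_norm_sq]
    simp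
    ring
  rw [h]
  nlinarith [sq_nonneg ‖c‖]

lemma deviation_le_sum_norm (hm : 1 ≤ m) (z : Fin m → V) : deviation z ≤ ∑ i, ‖z i‖ := by
  refine le_of_sq_le_sq ?_ (Finset.sum_nonneg fun i _ => norm_nonneg _)
  exact (deviation_sq_le hm z).trans
    (Finset.sum_sq_le_sq_sum_of_nonneg fun i _ => norm_nonneg (z i))

lemma deviation_le_of_norm_le (hm : 1 ≤ m) (z : Fin m → V) {δ : ℝ} (hδ : 0 ≤ δ)
    (hz : ∀ i, ‖z i‖ ≤ δ) : deviation z ≤ √m * δ := by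
  refine le_of_sq_le_sq ?_ (by positivity)
  refine (deviation_sq_le hm z).trans ?_
  rw [mul_pow, Real.sq_sqrt (Nat.cast_nonneg m)]
  calc ∑ i, ‖z i‖ ^ 2 ≤ ∑ _i : Fin m, δ ^ 2 :=
        Finset.sum_le_sum fun i _ => pow_le_pow_left₀ (norm_nonneg _) (hz i) 2
    _ = m * δ ^ 2 := by simp

lemma sum_mix {P : Matrix (Fin m) (Fin m) ℝ} (hcol : ∀ j, ∑ i, P i j = 1) (x : Fin m → V) :
    ∑ i, ∑ j, P i j • x j = ∑ j, x j := by
  rw [Finset.sum_comm]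
  exact Finset.sum_congr rfl fun j _ => by rw [← Finset.sum_smul, hcol, one_smul]

lemma mix_sub_mean {P : Matrix (Fin m) (Fin m) ℝ} (hrow : ∀ i, ∑ j, P i j = 1) (x : Fin m → V)
    (c : V) (i : Fin m) : ∑ j, P i j • x j - c = ∑ j, P i j • (x j - c) := by
  simp only [smul_sub, Finset.sum_sub_distrib, ← Finset.sum_smul, hrow, one_smul]

lemma deviation_mix_le {P : Matrix (Fin m) (Fin m) ℝ} (hnonneg : ∀ i j, 0 ≤ P i j)
    (hrow : ∀ i, ∑ j, P i j = 1) (hcol : ∀ j, ∑ i, P i j = 1) (x : Fin m → V) :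
    deviation (fun i => ∑ j, P i j • x j) ≤ deviation x := by
  refine le_of_sq_le_sq ?_ (deviation_nonneg x)
  simp only [deviation_sq, sum_mix hcol, mix_sub_mean hrow]
  set c := (1 / (m : ℝ)) • ∑ j, x j
  calc ∑ i, ‖∑ j, P i j • (x j - c)‖ ^ 2 ≤ ∑ i, ∑ j, P i j * ‖x j - c‖ ^ 2 := by
        refine Finset.sum_le_sum fun i _ => ?_
        refine le_trans (pow_le_pow_left₀ (norm_nonneg _) (norm_sum_le _ _) 2) ?_
        simp only [norm_smul, Real.norm_eq_abs, abs_of_nonneg (hnonneg i _)]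
        exact Real.pow_arith_mean_le_arith_mean_pow _ _ _ (fun j _ => hnonneg i j) (hrow i)
          (fun j _ => norm_nonneg _) 2
    _ = ∑ j, ‖x j - c‖ ^ 2 := by
        rw [Finset.sum_comm]
        exact Finset.sum_congr rfl fun j _ => by rw [← Finset.sum_mul, hcol, one_mul]

end Deviation

lemma deviation_block_contraction {d m B : ℕ} (hm : 2 ≤ m) {P : ℕ → Matrix (Fin m) (Fin m) ℝ}
    {ζ : ℝ} (hnonneg : ∀ t, ∀ i j, 0 ≤ P t i j) (hrow : ∀ t, ∀ i, ∑ j, P t i j = 1)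
    (hcol : ∀ t, ∀ j, ∑ i, P t i j = 1)
    (hζ : 0 < ζ) (hζ2 : ζ ≤ 1 / 2) (hdiag : ∀ t, ∀ i, ζ ≤ P t i i)
    (hedge : ∀ t, ∀ i j : Fin m, i ≠ j → (0 < P t i j ∨ 0 < P t j i) → ζ ≤ P t i j)
    (hconn : ∀ i j : Fin m,
      Relation.ReflTransGen (fun a b => a ≠ b ∧ ∃ t < B, (0 < P t a b ∨ 0 < P t b a)) i j)
    (x : ℕ → Fin m → EuclideanSpace ℝ (Fin d)) (hx : ∀ t i, x (t + 1) i = ∑ j, P t i j • x t j) :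
    deviation (x B) ≤ (1 - ζ / (4 * (m : ℝ) ^ 2)) ^ 8 * deviation (x 0) := by
  have hm2 : (2 : ℝ) ≤ m := by exact_mod_cast hm
  have hq : ζ / (4 * (m : ℝ) ^ 2) ≤ 1 / 32 := by
    rw [div_le_div_iff₀ (by positivity) (by norm_num)]
    nlinarith
  have hmean : ∀ t, ∑ j, x t j = ∑ j, x 0 j := by
    intro t
    induction t with
    | zero => rfl
    | succ t ih => simp only [hx]; rw [sum_mix (hcol t), ih]
  set c := (1 / (m : ℝ)) • ∑ j, x 0 j with hc
  have hsq : ∀ t, deviation (x t) ^ 2 = ∑ l, ∑ i, ((x t i - c) l) ^ 2 := by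
    intro t
    rw [deviation_sq, hmean t, Finset.sum_comm]
    exact Finset.sum_congr rfl fun i _ => by rw [EuclideanSpace.real_norm_sq_eq]
  refine le_of_sq_le_sq ?_ (mul_nonneg (pow_nonneg (by linarith) _) (deviation_nonneg _))
  rw [mul_pow, hsq, hsq, Finset.mul_sum]
  refine Finset.sum_le_sum fun l _ => ?_
  refine (energy_block_contraction hm hnonneg hrow hcol hζ hζ2 hdiag hedge hconn
    (fun t i => (x t i - c) l) ?_ ?_).trans ?_
  · intro t i
    simp only [hx, mix_sub_mean (hrow t)]
    simp
  · have : ∑ i, (x 0 i - c) = 0 := by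
      rw [Finset.sum_sub_distrib, hc]
      simp only [Finset.sum_const, Finset.card_univ, Fintype.card_fin, ← Nat.cast_smul_eq_nsmul ℝ,
        smul_smul]
      rw [mul_one_div_cancel (by positivity), one_smul, sub_self]
    simpa using congrArg (fun v : EuclideanSpace ℝ (Fin d) => v l) this
  · refine mul_le_mul_of_nonneg_right ?_ (Finset.sum_nonneg fun i _ => sq_nonneg _)
    rw [← pow_mul]
    have := one_add_mul_le_pow (a := -(ζ / (4 * (m : ℝ) ^ 2))) (by linarith) 16
    refine le_trans (le_of_eq ?_) (this.trans (le_of_eq ?_))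
    · push_cast; field_simp; ring
    · norm_num [sub_eq_add_neg]

/-- Iterates of the averaging recursion without perturbation. -/
noncomputable def averagingIterates {m : ℕ} {V : Type*} [AddCommGroup V] [Module ℝ V]
    (P : ℕ → Matrix (Fin m) (Fin m) ℝ) (z : Fin m → V) : ℕ → Fin m → V
  | 0 => z
  | t + 1 => fun i => ∑ j, P t i j • averagingIterates P z t j

lemma deviation_perturbed_step {m : ℕ} {V : Type*} [NormedAddCommGroup V] [InnerProductSpace ℝ V]
    (hm : 1 ≤ m) {P : Matrix (Fin m) (Fin m) ℝ} (hnonneg : ∀ i j, 0 ≤ P i j)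
    (hrow : ∀ i, ∑ j, P i j = 1) (hcol : ∀ j, ∑ i, P i j = 1) {x x' v : Fin m → V}
    {δ : ℝ} (hδ : 0 ≤ δ) (hv : ∀ i, ‖v i‖ ≤ δ) (hx : ∀ i, x' i = ∑ j, P i j • x j - v i) :
    deviation x' ≤ deviation x + √m * δ := by
  have h : x' = fun i => (fun i => ∑ j, P i j • x j) i + (fun i => -v i) i := by
    funext i
    rw [hx, sub_eq_add_neg]
  rw [h]
  refine (deviation_add_le _ _).trans (add_le_add (deviation_mix_le hnonneg hrow hcol x) ?_)
  exact deviation_le_of_norm_le hm _ hδ fun i => by rw [norm_neg]; exact hv i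

lemma deviation_perturbed_le {d m B : ℕ} (hm : 2 ≤ m) {P : ℕ → Matrix (Fin m) (Fin m) ℝ}
    {ζ : ℝ} (hnonneg : ∀ t, ∀ i j, 0 ≤ P t i j) (hrow : ∀ t, ∀ i, ∑ j, P t i j = 1)
    (hcol : ∀ t, ∀ j, ∑ i, P t i j = 1)
    (hζ : 0 < ζ) (hζ2 : ζ ≤ 1 / 2) (hdiag : ∀ t, ∀ i, ζ ≤ P t i i)
    (hedge : ∀ t, ∀ i j : Fin m, i ≠ j → (0 < P t i j ∨ 0 < P t j i) → ζ ≤ P t i j)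
    (hB : 1 ≤ B)
    (hconn : ∀ k : ℕ, ∀ i j : Fin m,
      Relation.ReflTransGen
        (fun a b => a ≠ b ∧ ∃ t, k * B ≤ t ∧ t < (k + 1) * B ∧
          (0 < P t a b ∨ 0 < P t b a)) i j)
    {z v : ℕ → Fin m → EuclideanSpace ℝ (Fin d)} {δ : ℝ} (hδ : 0 ≤ δ) (hv : ∀ t i, ‖v t i‖ ≤ δ)
    (hz : ∀ t i, z (t + 1) i = ∑ j, P t i j • z t j - v t i) (t : ℕ) :
    deviation (z t) ≤ (1 - ζ / (4 * (m : ℝ) ^ 2)) ^ (8 * (t / B)) * ∑ i, ‖z 0 i‖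
      + √m * δ * (B * (1 + 1 / (1 - (1 - ζ / (4 * (m : ℝ) ^ 2)) ^ 8))) := by
  have hm1 : 1 ≤ m := by omega
  have hm2 : (2 : ℝ) ≤ m := by exact_mod_cast hm
  have hq : ζ / (4 * (m : ℝ) ^ 2) ≤ 1 / 32 := by
    rw [div_le_div_iff₀ (by positivity) (by norm_num)]
    nlinarith
  have hq0 : 0 < ζ / (4 * (m : ℝ) ^ 2) := by positivity
  set l := 1 - ζ / (4 * (m : ℝ) ^ 2) with hl
  have hl0 : 0 ≤ l ^ 8 := pow_nonneg (by linarith) 8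
  have hl1 : l ^ 8 < 1 := pow_lt_one₀ (by linarith) (by linarith) (by norm_num)
  have hwithin : ∀ k s, deviation (z (k + s)) ≤ deviation (z k) + s * (√m * δ) := by
    intro k s
    induction s with
    | zero => simp
    | succ s ih =>
      have := deviation_perturbed_step hm1 (hnonneg _) (hrow _) (hcol _) hδ (hv (k + s))
        (hz (k + s))
      rw [← add_assoc]
      push_cast
      linarith
  have hlin : ∀ k s, deviation (fun i => z (k + s) i
      - averagingIterates (fun u => P (k + u)) (z k) s i) ≤ s * (√m * δ) := by
    intro k s
    induction s with
    | zero =>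
      simp only [averagingIterates, add_zero, sub_self, Nat.cast_zero, zero_mul]
      refine (deviation_le_of_norm_le hm1 _ le_rfl fun i => by simp).trans (by simp)
    | succ s ih =>
      have := deviation_perturbed_step hm1 (hnonneg (k + s)) (hrow _) (hcol _) hδ (hv (k + s))
        (x := fun i => z (k + s) i - averagingIterates (fun u => P (k + u)) (z k) s i)
        (x' := fun i => z (k + (s + 1)) i
          - averagingIterates (fun u => P (k + u)) (z k) (s + 1) i) (fun i => by
            rw [← add_assoc, hz, averagingIterates]
            simp only [smul_sub, Finset.sum_sub_distrib]
            abel)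
      push_cast
      linarith
  have hblock : ∀ n, deviation (z ((n + 1) * B)) ≤ l ^ 8 * deviation (z (n * B))
      + B * (√m * δ) := by
    intro n
    have hc := deviation_block_contraction hm (P := fun u => P (n * B + u)) (B := B)
      (fun t => hnonneg _) (fun t => hrow _) (fun t => hcol _) hζ hζ2 (fun t => hdiag _)
      (fun t => hedge _) (fun i j => Relation.ReflTransGen.mono (fun a b hab => by
        obtain ⟨hne, t, h1, h2, h3⟩ := hab
        refine ⟨hne, t - n * B, ?_, ?_⟩
        · rw [add_mul, one_mul] at h2; omega
        · rwa [Nat.add_sub_cancel' h1]) i j (hconn n i j))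
      (averagingIterates (fun u => P (n * B + u)) (z (n * B))) (fun t i => rfl)
    have ha := deviation_add_le (averagingIterates (fun u => P (n * B + u)) (z (n * B)) B)
      (fun i => z (n * B + B) i - averagingIterates (fun u => P (n * B + u)) (z (n * B)) B i)
    simp only [add_sub_cancel] at ha
    have := hlin (n * B) B
    rw [add_mul, one_mul]
    exact ha.trans (add_le_add hc this)
  have hstart : ∀ n, deviation (z (n * B)) ≤ (l ^ 8) ^ n * deviation (z 0)
      + B * (√m * δ) * (1 / (1 - l ^ 8)) := by
    intro n
    have hfix : B * (√m * δ) * (1 / (1 - l ^ 8)) =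
        l ^ 8 * (B * (√m * δ) * (1 / (1 - l ^ 8))) + B * (√m * δ) := by
      field_simp [(sub_pos.2 hl1).ne']
      ring
    induction n with
    | zero =>
      have : 0 ≤ B * (√m * δ) * (1 / (1 - l ^ 8)) :=
        mul_nonneg (by positivity) (one_div_nonneg.2 (sub_pos.2 hl1).le)
      simpa using this
    | succ n ih =>
      refine (hblock n).trans ?_
      rw [hfix, pow_succ' (l ^ 8) n]
      linarith [mul_le_mul_of_nonneg_left ih hl0]
  have h0 := mul_le_mul_of_nonneg_left (deviation_le_sum_norm hm1 (z 0))
    (pow_nonneg hl0 (t / B))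
  have h1 := hstart (t / B)
  have h2 := hwithin (t / B * B) (t % B)
  have h3 : ((t % B : ℕ) : ℝ) * (√m * δ) ≤ B * (√m * δ) :=
    mul_le_mul_of_nonneg_right (by exact_mod_cast (Nat.mod_lt t hB).le) (by positivity)
  rw [Nat.div_add_mod'] at h2
  rw [pow_mul]
  linarith

lemma mixing_rate_bound {l κ : ℝ} {B : ℕ} (hB : 1 ≤ B) (hl : 31 / 32 ≤ l) (hκ0 : 0 ≤ κ)
    (hκ1 : κ ≤ 1) (hκl : κ ^ B = l) (t : ℕ) :
    l ^ (8 * (t / B)) ≤ (l⁻¹) ^ 2 * (1.21 * κ ^ (8 * t)) := by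
  have hl0 : 0 < l := by linarith
  have h1 : l ^ 8 * l ^ (8 * (t / B)) ≤ κ ^ (8 * t) := by
    rw [← hκl, ← pow_mul, ← pow_mul, ← pow_add]
    refine pow_le_pow_of_le_one hκ0 hκ1 ?_
    have := Nat.lt_mul_div_succ t hB
    nlinarith
  have h2 : (1 : ℝ) ≤ l ^ 6 * 1.21 := by
    have := pow_le_pow_left₀ (by norm_num) hl 6
    norm_num at this ⊢
    linarith
  have h3 : 0 ≤ l ^ (8 * (t / B)) := by positivity
  calc l ^ (8 * (t / B)) ≤ (l ^ 6 * 1.21) * l ^ (8 * (t / B)) := le_mul_of_one_le_left h3 h2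
    _ = (l⁻¹) ^ 2 * (1.21 * (l ^ 8 * l ^ (8 * (t / B)))) := by field_simp
    _ ≤ _ := by gcongr

lemma mixing_noise_bound {l κ δ : ℝ} {B m : ℕ} (hm : 2 ≤ m) (hB : 1 ≤ B) (hl : 31 / 32 ≤ l)
    (hl1 : l < 1) (hκ0 : 0 ≤ κ) (hκ1 : κ < 1) (hκl : κ ^ B = l) (hδ : 0 ≤ δ) :
    √m * δ * (B * (1 + 1 / (1 - l ^ 8))) ≤ (l⁻¹) ^ 2 * (m * δ / (1 - κ) / 8) := by
  have hl0 : 0 < l := by linarith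
  have hm2 : (2 : ℝ) ≤ m := by exact_mod_cast hm
  have hB0 : (0 : ℝ) < B := by exact_mod_cast hB
  have hsq : √(m : ℝ) * √m = m := Real.mul_self_sqrt (by linarith)
  have hsm : 1.4 ≤ √(m : ℝ) := Real.le_sqrt_of_sq_le (by norm_num; linarith)
  have hgeom : B * (1 - κ) * l ≤ 1 - l := by
    have h := geom_sum_mul_neg κ B
    rw [hκl] at h
    have : (B : ℝ) * l ≤ ∑ i ∈ Finset.range B, κ ^ i := by
      have := Finset.card_nsmul_le_sum (Finset.range B) (fun i => κ ^ i) l fun i hi => by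
        rw [← hκl]
        exact pow_le_pow_of_le_one hκ0 hκ1.le (Finset.mem_range.1 hi).le
      simpa using this
    rw [← h]
    nlinarith
  have h8 : 7.125 * (1 - l) ≤ 1 - l ^ 8 := by
    have : 1 - l ^ 8 = (1 - l) * (1 + l + l ^ 2 + l ^ 3 + l ^ 4 + l ^ 5 + l ^ 6 + l ^ 7) := by ring
    rw [this, mul_comm]
    have hb : ∀ n : ℕ, 1 - n / 32 ≤ l ^ n := fun n => by
      have := one_add_mul_le_pow (a := l - 1) (by linarith) n
      rw [add_sub_cancel] at this
      nlinarith [Nat.cast_nonneg (α := ℝ) n]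
    have h2 := hb 2; have h3 := hb 3; have h4 := hb 4; have h5 := hb 5; have h6 := hb 6
    have h7 := hb 7
    norm_num at h2 h3 h4 h5 h6 h7
    exact mul_le_mul_of_nonneg_left (by linarith) (by linarith)
  have hx : 0 < 1 - l := by linarith
  have hk : 0 < 1 - κ := by linarith
  have hfac : (1 - l) * (1 + 1 / (1 - l ^ 8)) ≤ 1.4 / 8 := by
    have : (1 - l) * (1 / (1 - l ^ 8)) ≤ 1 / 7.125 := by
      rw [mul_one_div, div_le_div_iff₀ (by nlinarith) (by norm_num)]
      linarith
    rw [mul_add]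
    norm_num at this ⊢
    linarith
  have hF : 0 ≤ 1 + 1 / (1 - l ^ 8) := by
    have : 0 < 1 - l ^ 8 := by nlinarith
    positivity
  have hmain : 8 * (B * (1 - κ) * l) * (1 + 1 / (1 - l ^ 8)) * l ≤ √m := by
    have h1 : (B * (1 - κ) * l) * (1 + 1 / (1 - l ^ 8)) ≤ 1.4 / 8 :=
      (mul_le_mul_of_nonneg_right hgeom hF).trans hfac
    have h2 : 0 ≤ (B * (1 - κ) * l) * (1 + 1 / (1 - l ^ 8)) := by positivity
    have h3 : (B * (1 - κ) * l) * (1 + 1 / (1 - l ^ 8)) * l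
        ≤ (B * (1 - κ) * l) * (1 + 1 / (1 - l ^ 8)) := mul_le_of_le_one_right h2 hl1.le
    linarith
  have hrw : (l⁻¹) ^ 2 * (m * δ / (1 - κ) / 8) = √m * δ * √m / (8 * (1 - κ) * l ^ 2) := by
    rw [mul_right_comm, hsq]
    field_simp
  rw [hrw, le_div_iff₀ (by positivity)]
  have := mul_le_mul_of_nonneg_left hmain (by positivity : 0 ≤ √(m : ℝ) * δ)
  linarith

lemma deviation_le {d m B : ℕ} (hm : 2 ≤ m) {P : ℕ → Matrix (Fin m) (Fin m) ℝ}
    {ζ : ℝ} (hnonneg : ∀ t, ∀ i j, 0 ≤ P t i j) (hrow : ∀ t, ∀ i, ∑ j, P t i j = 1)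
    (hcol : ∀ t, ∀ j, ∑ i, P t i j = 1)
    (hζ : 0 < ζ) (hζ2 : ζ ≤ 1 / 2) (hdiag : ∀ t, ∀ i, ζ ≤ P t i i)
    (hedge : ∀ t, ∀ i j : Fin m, i ≠ j → (0 < P t i j ∨ 0 < P t j i) → ζ ≤ P t i j)
    (hB : 1 ≤ B)
    (hconn : ∀ k : ℕ, ∀ i j : Fin m,
      Relation.ReflTransGen
        (fun a b => a ≠ b ∧ ∃ t, k * B ≤ t ∧ t < (k + 1) * B ∧
          (0 < P t a b ∨ 0 < P t b a)) i j)
    {κ : ℝ} (hκ0 : 0 ≤ κ) (hκ1 : κ < 1) (hκl : κ ^ B = 1 - ζ / (4 * (m : ℝ) ^ 2))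
    {z v : ℕ → Fin m → EuclideanSpace ℝ (Fin d)} {δ : ℝ} (hδ : 0 ≤ δ) (hv : ∀ t i, ‖v t i‖ ≤ δ)
    (hz : ∀ t i, z (t + 1) i = ∑ j, P t i j • z t j - v t i) (t : ℕ) :
    deviation (z t) ≤ ((1 - ζ / (4 * (m : ℝ) ^ 2))⁻¹) ^ 2 *
      (1.21 * κ ^ (8 * t) * ∑ i, ‖z 0 i‖ + m * δ / (1 - κ) / 8) := by
  have hm2 : (2 : ℝ) ≤ m := by exact_mod_cast hm
  have hq : ζ / (4 * (m : ℝ) ^ 2) ≤ 1 / 32 := by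
    rw [div_le_div_iff₀ (by positivity) (by norm_num)]
    nlinarith
  have hq0 : 0 < ζ / (4 * (m : ℝ) ^ 2) := by positivity
  refine (deviation_perturbed_le hm hnonneg hrow hcol hζ hζ2 hdiag hedge hB hconn hδ hv hz t).trans
    ?_
  set l := 1 - ζ / (4 * (m : ℝ) ^ 2) with hl
  have h1 := mul_le_mul_of_nonneg_right
    (mixing_rate_bound hB (by linarith : 31 / 32 ≤ l) hκ0 hκ1.le hκl t)
    (Finset.sum_nonneg fun i _ => norm_nonneg (z 0 i) : 0 ≤ ∑ i, ‖z 0 i‖)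
  have h2 := mixing_noise_bound hm hB (by linarith : 31 / 32 ≤ l) (by linarith) hκ0 hκ1 hκl hδ
  linarith

/-- The Bregman divergence of `φ`, where `g` plays the role of the gradient of `φ`. -/
noncomputable def bregman {V : Type*} [NormedAddCommGroup V] [InnerProductSpace ℝ V]
    (φ : V → ℝ) (g : V → V) (x y : V) : ℝ := φ x - φ y - ⟪g y, x - y⟫

section Bregman

variable {V : Type*} [NormedAddCommGroup V] [InnerProductSpace ℝ V] {φ : V → ℝ} {g : V → V}

lemma bregman_three_point (x b c : V) :
    bregman φ g x c = bregman φ g x b + ⟪g b - g c, x - c⟫ - bregman φ g c b := by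
  have : x - b = (x - c) + (c - b) := by abel
  simp only [bregman]
  rw [this, inner_add_right, inner_sub_left]
  ring

lemma bregman_add_bregman_swap (x y : V) :
    bregman φ g x y + bregman φ g y x = ⟪g x - g y, x - y⟫ := by
  have : y - x = -(x - y) := by abel
  simp only [bregman]
  rw [this, inner_neg_right, inner_sub_left]
  ring

lemma sum_bregman_eq {ι : Type*} [Fintype ι] {p : ι → ℝ} (hp : ∑ j, p j = 1) {w : ι → V} {y : V}
    (hy : g y = ∑ j, p j • g (w j)) (x : V) :
    ∑ j, p j * bregman φ g x (w j) = bregman φ g x y + ∑ j, p j * bregman φ g y (w j) := by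
  have h : ∀ j, p j * bregman φ g x (w j) - p j * bregman φ g y (w j)
      = p j * (φ x - φ y) - ⟪p j • g (w j), x - y⟫ := by
    intro j
    have : x - w j = (x - y) + (y - w j) := by abel
    simp only [bregman, real_inner_smul_left]
    rw [this, inner_add_right]
    ring
  have hs := Finset.sum_congr rfl fun j (_ : j ∈ Finset.univ) => h j
  rw [Finset.sum_sub_distrib, Finset.sum_sub_distrib, ← Finset.sum_mul, hp, one_mul, ← sum_inner,
    ← hy] at hs
  simp only [bregman] at hs ⊢
  linarith

variable {c r : ℝ}

lemma le_bregman (hUC : ∀ x y, φ y + ⟪g y, x - y⟫ + c * ‖x - y‖ ^ r ≤ φ x) (x y : V) :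
    c * ‖x - y‖ ^ r ≤ bregman φ g x y := by
  have := hUC x y
  simp only [bregman]
  linarith

lemma bregman_nonneg (hc : 0 ≤ c) (hUC : ∀ x y, φ y + ⟪g y, x - y⟫ + c * ‖x - y‖ ^ r ≤ φ x)
    (x y : V) : 0 ≤ bregman φ g x y :=
  (mul_nonneg hc (Real.rpow_nonneg (norm_nonneg _) _)).trans (le_bregman hUC x y)

lemma norm_sub_le_of_norm_grad_sub_le (hc : 0 < c) (hr : 1 < r)
    (hUC : ∀ x y, φ y + ⟪g y, x - y⟫ + c * ‖x - y‖ ^ r ≤ φ x) {x y : V} {a : ℝ}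
    (h : ‖g x - g y‖ ≤ a) : ‖x - y‖ ≤ (a / (2 * c)) ^ (1 / (r - 1)) := by
  have ha : 0 ≤ a := (norm_nonneg _).trans h
  rcases eq_or_ne x y with rfl | hxy
  · rw [sub_self, norm_zero]; positivity
  have hpos : 0 < ‖x - y‖ := norm_pos_iff.2 (sub_ne_zero.2 hxy)
  have h1 := le_bregman hUC x y
  have h2 := le_bregman hUC y x
  rw [norm_sub_rev y x] at h2
  have h3 : 2 * c * ‖x - y‖ ^ r ≤ a * ‖x - y‖ := by
    have h4 := bregman_add_bregman_swap (φ := φ) (g := g) x y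
    have h5 := (real_inner_le_norm (g x - g y) (x - y)).trans
      (mul_le_mul_of_nonneg_right h hpos.le)
    linarith
  have h4 : ‖x - y‖ ^ r = ‖x - y‖ ^ (r - 1) * ‖x - y‖ := by
    rw [← Real.rpow_add_one hpos.ne', sub_add_cancel]
  rw [h4, ← mul_assoc] at h3
  have h5 : ‖x - y‖ ^ (r - 1) ≤ a / (2 * c) := by
    rw [le_div_iff₀ (by positivity), mul_comm]
    exact le_of_mul_le_mul_right h3 hpos
  rw [one_div]
  exact (Real.le_rpow_inv_iff_of_pos hpos.le (by positivity) (by linarith)).2 h5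

end Bregman

/-- A scaled form of Young's inequality. -/
lemma mul_sub_rpow_le {G p k r : ℝ} (hG : 0 ≤ G) (hp : 0 ≤ p) (hk : 0 < k) (hr : 1 < r) :
    G * p - k * p ^ r / r ≤ (r - 1) / r * (G ^ r / k) ^ (1 / (r - 1)) := by
  have hr0 : 0 < r := by linarith
  have hr1 : 0 < r - 1 := by linarith
  have hconj : r.HolderConjugate (r / (r - 1)) := Real.HolderConjugate.conjExponent hr
  have hy := Real.young_inequality_of_nonneg (a := k ^ (1 / r) * p) (b := G / k ^ (1 / r))
    (by positivity) (by positivity) hconj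
  have e1 : k ^ (1 / r) * p * (G / k ^ (1 / r)) = G * p := by
    have : k ^ (1 / r) ≠ 0 := by positivity
    field_simp
  have e2 : (k ^ (1 / r) * p) ^ r = k * p ^ r := by
    rw [Real.mul_rpow (by positivity) hp, ← Real.rpow_mul hk.le, one_div_mul_cancel hr0.ne',
      Real.rpow_one]
  have e3 : (G / k ^ (1 / r)) ^ (r / (r - 1)) = (G ^ r / k) ^ (1 / (r - 1)) := by
    rw [show r / (r - 1) = r * (1 / (r - 1)) by ring, Real.rpow_mul (by positivity),
      Real.div_rpow hG (by positivity), ← Real.rpow_mul hk.le, one_div_mul_cancel hr0.ne',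
      Real.rpow_one]
  rw [e1, e2, e3] at hy
  have e4 : (G ^ r / k) ^ (1 / (r - 1)) / (r / (r - 1))
      = (r - 1) / r * (G ^ r / k) ^ (1 / (r - 1)) := by
    field_simp
  linarith

section Geometry

variable {V : Type*} [NormedAddCommGroup V] [InnerProductSpace ℝ V]

lemma add_le_of_weighted_sq_le {a b α β C : ℝ} (hα : 0 < α) (hβ : 0 < β) (hαβ : α + β = 1)
    (hC : 0 ≤ C) (h : a ^ 2 / α + b ^ 2 / β ≤ C ^ 2) : a + b ≤ C := by
  refine le_of_sq_le_sq (le_trans ?_ h) hC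
  have e : a ^ 2 / α + b ^ 2 / β - (a + b) ^ 2 = (a * β - b * α) ^ 2 / (α * β) := by
    obtain rfl : β = 1 - α := by linarith
    field_simp
    ring
  have : 0 ≤ (a * β - b * α) ^ 2 / (α * β) := by positivity
  linarith

lemma norm_midpoint_add_norm_lookahead_zero {e e' : V} {ε : ℝ} (he : ‖e‖ ≤ ε) (he' : ‖e'‖ ≤ ε) :
    ‖(1 / 2 : ℝ) • (e + e')‖ + ‖e - (1 / 5 : ℝ) • e'‖ ≤ 1.83 * ε := by
  have hε : 0 ≤ ε := (norm_nonneg e).trans he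
  have h1 : ‖e‖ ^ 2 ≤ ε ^ 2 := pow_le_pow_left₀ (norm_nonneg _) he 2
  have h2 : ‖e'‖ ^ 2 ≤ ε ^ 2 := pow_le_pow_left₀ (norm_nonneg _) he' 2
  refine add_le_of_weighted_sq_le (α := 5 / 9) (β := 4 / 9) (by norm_num) (by norm_num)
    (by norm_num) (by positivity) ?_
  simp only [← real_inner_self_eq_norm_sq, inner_add_left, inner_add_right, inner_sub_left,
    inner_sub_right, real_inner_smul_left, real_inner_smul_right, real_inner_comm e e'] at *
  nlinarith

lemma norm_midpoint_add_norm_lookahead_boundary {e e' p : V} {ε : ℝ} (he : ‖e‖ ≤ ε)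
    (he' : ‖e'‖ ≤ ε) (hp : ‖p‖ ≤ ε) :
    ‖(1 / 2 : ℝ) • (e + e' - p)‖ + ‖e + p - (1 / 5 : ℝ) • e'‖ ≤ 2.83 * ε := by
  have hε : 0 ≤ ε := (norm_nonneg e).trans he
  have h1 : ‖e‖ ^ 2 ≤ ε ^ 2 := pow_le_pow_left₀ (norm_nonneg _) he 2
  have h2 : ‖e'‖ ^ 2 ≤ ε ^ 2 := pow_le_pow_left₀ (norm_nonneg _) he' 2
  have h3 : ‖p‖ ^ 2 ≤ ε ^ 2 := pow_le_pow_left₀ (norm_nonneg _) hp 2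
  have hin : ∀ a b : V, ‖a‖ ≤ ε → ‖b‖ ≤ ε → |⟪a, b⟫| ≤ ε ^ 2 := fun a b ha hb => by
    rw [pow_two]
    exact (abs_real_inner_le_norm a b).trans (mul_le_mul ha hb (norm_nonneg _) hε)
  have h4 := abs_le.1 (hin e e' he he')
  have h5 := abs_le.1 (hin e p he hp)
  have h6 := abs_le.1 (hin e' p he' hp)
  have h7 := sq_nonneg ‖(1.1745 : ℝ) • p - (0.5513 : ℝ) • e + (0.9316 : ℝ) • e'‖
  refine add_le_of_weighted_sq_le (α := 0.311) (β := 0.689) (by norm_num) (by norm_num)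
    (by norm_num) (by positivity) ?_
  simp only [← real_inner_self_eq_norm_sq, inner_add_left, inner_add_right, inner_sub_left,
    inner_sub_right, real_inner_smul_left, real_inner_smul_right, real_inner_comm e e',
    real_inner_comm e p, real_inner_comm e' p] at *
  norm_num at *
  linarith

lemma norm_midpoint_add_norm_lookahead {e e' p : V} {ε : ℝ} (he : ‖e‖ ≤ ε)
    (he' : ‖e'‖ ≤ ε) (hp : ‖p‖ ≤ ε) :
    ‖(1 / 2 : ℝ) • (e + e' - p)‖ + ‖e + p - (1 / 5 : ℝ) • e'‖ ≤ 1.83 * ε + ‖p‖ := by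
  have hε : 0 ≤ ε := (norm_nonneg e).trans he
  have h0 := norm_midpoint_add_norm_lookahead_zero he he'
  rcases eq_or_ne p 0 with rfl | hp0
  · simpa using h0
  have hpos : 0 < ‖p‖ := norm_pos_iff.2 hp0
  have hεpos : 0 < ε := hpos.trans_le hp
  set θ := ‖p‖ / ε with hθ
  have hθ0 : 0 < θ := by positivity
  have hθ1 : θ ≤ 1 := by rw [hθ, div_le_one hεpos]; exact hp
  set q := θ⁻¹ • p with hq
  have hpq : p = θ • q := by rw [hq, smul_smul, mul_inv_cancel₀ hθ0.ne', one_smul]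
  have hqn : ‖q‖ ≤ ε := by
    rw [hq, norm_smul, norm_inv, Real.norm_of_nonneg hθ0.le, hθ, inv_div,
      div_mul_cancel₀ _ hpos.ne']
  have h1 := norm_midpoint_add_norm_lookahead_boundary he he' hqn
  have hθε : θ * ε = ‖p‖ := by rw [hθ, div_mul_cancel₀ _ hεpos.ne']
  have hA : ‖(1 / 2 : ℝ) • (e + e' - p)‖ ≤ (1 - θ) * ‖(1 / 2 : ℝ) • (e + e')‖
      + θ * ‖(1 / 2 : ℝ) • (e + e' - q)‖ := by
    have : (1 / 2 : ℝ) • (e + e' - p) = (1 - θ) • ((1 / 2 : ℝ) • (e + e'))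
        + θ • ((1 / 2 : ℝ) • (e + e' - q)) := by
      rw [hpq]; module
    rw [this]
    refine (norm_add_le _ _).trans (le_of_eq ?_)
    rw [norm_smul, norm_smul θ, Real.norm_of_nonneg hθ0.le, Real.norm_of_nonneg (by linarith)]
  have hB : ‖e + p - (1 / 5 : ℝ) • e'‖ ≤ (1 - θ) * ‖e - (1 / 5 : ℝ) • e'‖
      + θ * ‖e + q - (1 / 5 : ℝ) • e'‖ := by
    have : e + p - (1 / 5 : ℝ) • e' = (1 - θ) • (e - (1 / 5 : ℝ) • e')
        + θ • (e + q - (1 / 5 : ℝ) • e') := by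
      rw [hpq]; module
    rw [this]
    refine (norm_add_le _ _).trans (le_of_eq ?_)
    rw [norm_smul, norm_smul θ, Real.norm_of_nonneg hθ0.le, Real.norm_of_nonneg (by linarith)]
  have h2 := mul_le_mul_of_nonneg_left h0 (by linarith : 0 ≤ 1 - θ)
  have h3 := mul_le_mul_of_nonneg_left h1 hθ0.le
  linarith

end Geometry

section MirrorStep

variable {V : Type*} [NormedAddCommGroup V] [InnerProductSpace ℝ V] {φ : V → ℝ} {g : V → V}

/-- One step of mirror descent on the average, with gradients evaluated at nearby points. -/
lemma mean_mirror_step {m : ℕ} (hm : 1 ≤ m) {σ r η G ε : ℝ} (hσ : 0 < σ) (hr : 2 ≤ r) (hη : 0 < η)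
    (hG : 0 ≤ G) (hUC : ∀ x y, φ y + ⟪g y, x - y⟫ + σ / r * ‖x - y‖ ^ r ≤ φ x)
    {f : Fin m → V → ℝ} (hLip : ∀ i x y, |f i x - f i y| ≤ G * ‖x - y‖)
    {w u : Fin m → V} {b b' xs : V} (hu : ∀ i, ‖u i‖ ≤ G)
    (hfirst : ∀ i x, f i (w i) + ⟪u i, x - w i⟫ ≤ f i x)
    (hb : g b' = g b - (η / m) • ∑ i, u i) (hε : ∀ i, ‖w i - b‖ ≤ ε) :
    (∑ i, f i b - ∑ i, f i xs) / m + (bregman φ g xs b' - bregman φ g xs b) / η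
      ≤ 2 * G * ε + (r - 1) / r * (η * G ^ r / σ) ^ (1 / (r - 1)) := by
  have hm0 : (0 : ℝ) < m := by exact_mod_cast hm
  have hr0 : 0 < r := by linarith
  have h1 := bregman_three_point (φ := φ) (g := g) xs b b'
  have hdiff : g b - g b' = (η / m) • ∑ i, u i := by rw [hb]; abel
  rw [hdiff, real_inner_smul_left, sum_inner] at h1
  have h2 := le_bregman hUC b' b
  set p := ‖b' - b‖ with hp
  have h3 : ∀ i, ⟪u i, xs - b'⟫ ≤ f i xs - f i b + G * (2 * ε + p) := by
    intro i
    have e : xs - b' = (xs - w i) + ((w i - b) - (b' - b)) := by abel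
    have l1 : ⟪u i, (w i - b) - (b' - b)⟫ ≤ G * (ε + p) := by
      refine (real_inner_le_norm _ _).trans (mul_le_mul (hu i) ?_ (norm_nonneg _) hG)
      exact (norm_sub_le _ _).trans (add_le_add (hε i) le_rfl)
    have l2 := hfirst i xs
    have l3 := (le_abs_self _).trans (hLip i b (w i))
    have l4 := mul_le_mul_of_nonneg_left (hε i) hG
    rw [norm_sub_rev] at l3
    rw [e, inner_add_right]
    linarith
  have h4 := Finset.sum_le_sum fun i (_ : i ∈ Finset.univ) => h3 i
  rw [Finset.sum_add_distrib, Finset.sum_sub_distrib] at h4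
  simp only [Finset.sum_const, Finset.card_univ, Fintype.card_fin, nsmul_eq_mul] at h4
  have h5 := mul_sub_rpow_le hG (norm_nonneg (b' - b)) (div_pos hσ hη) (by linarith : 1 < r)
  rw [← hp, show G ^ r / (σ / η) = η * G ^ r / σ by field_simp] at h5
  refine le_trans ?_ (add_le_add_right h5 _)
  set S := ∑ i, ⟪u i, xs - b'⟫
  have h6 : (bregman φ g xs b' - bregman φ g xs b) / η ≤ S / m - σ / η * p ^ r / r := by
    rw [h1, div_le_iff₀ hη]
    have : (S / m - σ / η * p ^ r / r) * η = η / m * S - σ / r * p ^ r := by field_simp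
    rw [this]
    linarith
  have h7 : (∑ i, f i b - ∑ i, f i xs) / m + S / m ≤ G * (2 * ε + p) := by
    rw [← add_div, div_le_iff₀ hm0]
    linarith
  linarith

/-- One step for the mixture of the potentials of the average and of the agents. -/
lemma mixed_potential_step {m : ℕ} (hm : 1 ≤ m) {σ r η G ε : ℝ} (hσ : 0 < σ) (hr : 2 ≤ r)
    (hη : 0 < η) (hG : 0 ≤ G) (hUC : ∀ x y, φ y + ⟪g y, x - y⟫ + σ / r * ‖x - y‖ ^ r ≤ φ x)
    {f : Fin m → V → ℝ} (hconv : ∀ i, ConvexOn ℝ Set.univ (f i))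
    (hLip : ∀ i x y, |f i x - f i y| ≤ G * ‖x - y‖)
    {P : Matrix (Fin m) (Fin m) ℝ} (hnonneg : ∀ i j, 0 ≤ P i j)
    (hrow : ∀ i, ∑ j, P i j = 1) (hcol : ∀ j, ∑ i, P i j = 1)
    {w w' y u : Fin m → V} {b b' xs : V} (hu : ∀ i, ‖u i‖ ≤ G)
    (hfirst : ∀ i x, f i (w i) + ⟪u i, x - w i⟫ ≤ f i x)
    (hy : ∀ i, g (y i) = ∑ j, P i j • g (w j)) (hw : ∀ i, g (w' i) = g (y i) - η • u i)
    (hb : g b' = g b - (η / m) • ∑ i, u i)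
    (hε : ∀ i, ‖w i - b‖ ≤ ε) (hε' : ∀ i, ‖w' i - b'‖ ≤ ε) (hp : ‖b' - b‖ ≤ ε) :
    (∑ i, f i b - ∑ i, f i xs) / m
      ≤ (4 / 5 * (bregman φ g xs b - bregman φ g xs b')
          + 1 / 5 * ((∑ i, bregman φ g xs (w i) - ∑ i, bregman φ g xs (w' i)) / m)) / η
        + 1 / 2 * ((∑ i, f i (w' i) - ∑ i, f i (w i)) / m)
        + G * (1.83 * ε) + (r - 1) / r * (5 / 4 * (η * G ^ r / σ)) ^ (1 / (r - 1)) := by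
  have hm0 : (0 : ℝ) < m := by exact_mod_cast hm
  have hr0 : 0 < r := by linarith
  have hc : 0 ≤ σ / r := by positivity
  have h1 := bregman_three_point (φ := φ) (g := g) xs b b'
  have hdiff : g b - g b' = (η / m) • ∑ i, u i := by rw [hb]; abel
  rw [hdiff, real_inner_smul_left, sum_inner] at h1
  have h2 := le_bregman hUC b' b
  have hagent : ∑ i, bregman φ g xs (w' i)
      ≤ ∑ i, bregman φ g xs (w i) + η * ∑ i, ⟪u i, xs - w' i⟫ := by
    have hmix : ∑ i, bregman φ g xs (y i) ≤ ∑ j, bregman φ g xs (w j) := by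
      calc ∑ i, bregman φ g xs (y i) ≤ ∑ i, ∑ j, P i j * bregman φ g xs (w j) := by
            refine Finset.sum_le_sum fun i _ => ?_
            rw [sum_bregman_eq (hrow i) (hy i) xs]
            exact le_add_of_nonneg_right (Finset.sum_nonneg fun j _ =>
              mul_nonneg (hnonneg i j) (bregman_nonneg hc hUC _ _))
        _ = ∑ j, bregman φ g xs (w j) := by
            rw [Finset.sum_comm]
            exact Finset.sum_congr rfl fun j _ => by rw [← Finset.sum_mul, hcol, one_mul]
    have hstep : ∀ i, bregman φ g xs (w' i) ≤ bregman φ g xs (y i) + η * ⟪u i, xs - w' i⟫ := by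
      intro i
      have h := bregman_three_point (φ := φ) (g := g) xs (y i) (w' i)
      have hd : g (y i) - g (w' i) = η • u i := by rw [hw]; abel
      rw [hd, real_inner_smul_left] at h
      have := bregman_nonneg hc hUC (w' i) (y i)
      linarith
    have := Finset.sum_le_sum fun i (_ : i ∈ Finset.univ) => hstep i
    rw [Finset.sum_add_distrib, ← Finset.mul_sum] at this
    linarith
  set p := ‖b' - b‖ with hpdef
  have h3 : ∀ i, 4 / 5 * ⟪u i, xs - b'⟫ + 1 / 5 * ⟪u i, xs - w' i⟫
      ≤ f i xs - f i b + 1 / 2 * (f i (w' i) - f i (w i)) + G * (1.83 * ε + p) := by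
    intro i
    set e := w i - b with he
    set e' := w' i - b' with he'
    set q := b - b' with hq
    have hqn : ‖q‖ = p := norm_sub_rev _ _
    have hgeo := norm_midpoint_add_norm_lookahead (hε i) (hε' i) (hqn.le.trans hp)
    rw [hqn] at hgeo
    have l1 : 4 / 5 * ⟪u i, xs - b'⟫ + 1 / 5 * ⟪u i, xs - w' i⟫
        = ⟪u i, xs - w i⟫ + ⟪u i, e + q - (1 / 5 : ℝ) • e'⟫ := by
      rw [← real_inner_smul_right, ← real_inner_smul_right, ← inner_add_right, ← inner_add_right]
      congr 1
      rw [he, he', hq]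
      module
    have l2 : ⟪u i, e + q - (1 / 5 : ℝ) • e'⟫ ≤ G * ‖e + q - (1 / 5 : ℝ) • e'‖ :=
      (real_inner_le_norm _ _).trans (mul_le_mul_of_nonneg_right (hu i) (norm_nonneg _))
    have l3 := hfirst i xs
    have l4 := (hconv i).2 (Set.mem_univ (w i)) (Set.mem_univ (w' i))
      (by norm_num : (0 : ℝ) ≤ 1 / 2) (by norm_num : (0 : ℝ) ≤ 1 / 2) (by norm_num)
    have l5 := (le_abs_self _).trans (hLip i b ((1 / 2 : ℝ) • w i + (1 / 2 : ℝ) • w' i))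
    have l6 : b - ((1 / 2 : ℝ) • w i + (1 / 2 : ℝ) • w' i) = -((1 / 2 : ℝ) • (e + e' - q)) := by
      rw [he, he', hq]
      module
    rw [l6, norm_neg] at l5
    simp only [smul_eq_mul] at l4
    have l7 := mul_le_mul_of_nonneg_left hgeo hG
    linarith
  have h4 := Finset.sum_le_sum fun i (_ : i ∈ Finset.univ) => h3 i
  simp only [Finset.sum_add_distrib, Finset.sum_sub_distrib, ← Finset.mul_sum, Finset.sum_const,
    Finset.card_univ, Fintype.card_fin, nsmul_eq_mul] at h4
  have h5 := mul_sub_rpow_le hG (norm_nonneg (b' - b)) (by positivity : 0 < 4 / 5 * (σ / η))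
    (by linarith : 1 < r)
  rw [← hpdef, show G ^ r / (4 / 5 * (σ / η)) = 5 / 4 * (η * G ^ r / σ) by field_simp] at h5
  refine le_trans ?_ (add_le_add_right h5 _)
  set S := ∑ i, ⟪u i, xs - b'⟫
  set S' := ∑ i, ⟪u i, xs - w' i⟫
  have h6 : S / m - σ / η * p ^ r / r ≥ (bregman φ g xs b' - bregman φ g xs b) / η := by
    rw [h1, ge_iff_le, div_le_iff₀ hη]
    have : (S / m - σ / η * p ^ r / r) * η = η / m * S - σ / r * p ^ r := by field_simp
    rw [this]
    linarith
  have h7 : (∑ i, bregman φ g xs (w' i) - ∑ i, bregman φ g xs (w i)) / m / η ≤ S' / m := by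
    rw [div_div, div_le_div_iff₀ (by positivity) hm0]
    nlinarith
  have h8 : (∑ i, f i b - ∑ i, f i xs) / m ≤ 1 / 2 * ((∑ i, f i (w' i) - ∑ i, f i (w i)) / m)
      + G * (1.83 * ε + p) - (4 / 5 * (S / m) + 1 / 5 * (S' / m)) := by
    rw [div_le_iff₀ hm0]
    have : (1 / 2 * ((∑ i, f i (w' i) - ∑ i, f i (w i)) / m)
      + G * (1.83 * ε + p) - (4 / 5 * (S / m) + 1 / 5 * (S' / m))) * m
      = 1 / 2 * (∑ i, f i (w' i) - ∑ i, f i (w i)) + m * (G * (1.83 * ε + p))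
        - (4 / 5 * S + 1 / 5 * S') := by
      field_simp
    rw [this]
    linarith
  have h9 : (4 / 5 * (bregman φ g xs b - bregman φ g xs b')
          + 1 / 5 * ((∑ i, bregman φ g xs (w i) - ∑ i, bregman φ g xs (w' i)) / m)) / η
      = -(4 / 5 * ((bregman φ g xs b' - bregman φ g xs b) / η)
        + 1 / 5 * ((∑ i, bregman φ g xs (w' i) - ∑ i, bregman φ g xs (w i)) / m / η)) := by
    ring
  have h10 : 4 / 5 * (σ / η) * p ^ r / r = 4 / 5 * (σ / η * p ^ r / r) := by ring
  rw [h9, h10]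
  linarith

end MirrorStep

section RealBounds

/-- Weights that are at most `A` early and at most `b` later average to at most `1` against a
sequence decaying at most geometrically. -/
lemma sum_weight_sub_one_mul_nonpos {L ω : ℕ → ℝ} {q A b : ℝ} {k n : ℕ} (hq0 : 0 < q) (hq1 : q < 1)
    (hL0 : ∀ t, 0 ≤ L t) (hL : ∀ t, q * L t ≤ L (t + 1)) (hA : 1 ≤ A) (hb : b ≤ 1) (hkn : k ≤ n)
    (hωA : ∀ t < k, ω t ≤ A) (hωb : ∀ t, k ≤ t → t < n → ω t ≤ b)
    (hqk : A - 1 + (1 - b) * q ^ n ≤ q ^ k * (A - b)) :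
    ∑ t ∈ Finset.range n, (ω t - 1) * L t ≤ 0 := by
  set W : ℕ → ℝ := fun t => L t / q ^ t with hW
  have hLW : ∀ t, L t = W t * q ^ t := fun t => by
    rw [hW]; field_simp
  have hW0 : ∀ t, 0 ≤ W t := fun t => div_nonneg (hL0 t) (by positivity)
  have hmono : Monotone W := monotone_nat_of_le_succ fun t => by
    rw [hW]
    simp only
    rw [div_le_div_iff₀ (by positivity) (by positivity), pow_succ]
    have := mul_le_mul_of_nonneg_right (hL t) (by positivity : 0 ≤ q ^ t)
    linarith
  have hgeom : ∀ j, (∑ t ∈ Finset.range j, q ^ t) * (1 - q) = 1 - q ^ j := fun j => by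
    have := geom_sum_mul_neg q j
    linarith
  have hfirst : ∑ t ∈ Finset.range k, (ω t - 1) * L t
      ≤ (A - 1) * W k * ∑ t ∈ Finset.range k, q ^ t := by
    rw [Finset.mul_sum]
    refine Finset.sum_le_sum fun t ht => ?_
    have ht := Finset.mem_range.1 ht
    calc (ω t - 1) * L t ≤ (A - 1) * L t :=
          mul_le_mul_of_nonneg_right (by linarith [hωA t ht]) (hL0 t)
      _ ≤ (A - 1) * (W k * q ^ t) := by
          rw [hLW]
          have := hmono ht.le
          gcongr
      _ = _ := by ring
  have hsecond : ∑ t ∈ Finset.Ico k n, (ω t - 1) * L t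
      ≤ (b - 1) * W k * ∑ t ∈ Finset.Ico k n, q ^ t := by
    rw [Finset.mul_sum]
    refine Finset.sum_le_sum fun t ht => ?_
    obtain ⟨h1, h2⟩ := Finset.mem_Ico.1 ht
    have h3 : W k * q ^ t ≤ L t := by
      rw [hLW]
      exact mul_le_mul_of_nonneg_right (hmono h1) (by positivity)
    calc (ω t - 1) * L t ≤ (b - 1) * L t :=
          mul_le_mul_of_nonneg_right (by linarith [hωb t h1 h2]) (hL0 t)
      _ ≤ (b - 1) * (W k * q ^ t) := mul_le_mul_of_nonpos_left h3 (by linarith)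
      _ = _ := by ring
  have hIco := Finset.sum_range_add_sum_Ico (fun t => q ^ t) hkn
  rw [← Finset.sum_range_add_sum_Ico _ hkn]
  refine (add_le_add hfirst hsecond).trans ?_
  have hq : 0 < 1 - q := by linarith
  refine nonpos_of_mul_nonpos_left (b := 1 - q) ?_ hq
  have hI : (∑ t ∈ Finset.Ico k n, q ^ t) * (1 - q) = q ^ k - q ^ n := by
    have h1 := hgeom k
    have h2 := hgeom n
    rw [← hIco] at h2
    linarith
  calc ((A - 1) * W k * ∑ t ∈ Finset.range k, q ^ t
        + (b - 1) * W k * ∑ t ∈ Finset.Ico k n, q ^ t) * (1 - q)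
      = (A - 1) * W k * ((∑ t ∈ Finset.range k, q ^ t) * (1 - q))
        + (b - 1) * W k * ((∑ t ∈ Finset.Ico k n, q ^ t) * (1 - q)) := by ring
    _ = W k * (A - 1 + (1 - b) * q ^ n - q ^ k * (A - b)) := by rw [hgeom, hI]; ring
    _ ≤ 0 := mul_nonpos_of_nonneg_of_nonpos (hW0 k) (by linarith)

lemma rpow_inv_le_mul {r a X Y : ℝ} (hr : 1 < r) (ha : 0 ≤ a) (hX : 0 ≤ X) (hY : 0 ≤ Y)
    (h : a ≤ X ^ (r - 1) * Y) : a ^ (1 / (r - 1)) ≤ X * Y ^ (1 / (r - 1)) := by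
  have hr1 : 0 < r - 1 := by linarith
  refine (Real.rpow_le_rpow ha h (by positivity)).trans (le_of_eq ?_)
  rw [Real.mul_rpow (by positivity) hY, ← Real.rpow_mul hX, mul_one_div_cancel hr1.ne',
    Real.rpow_one]

lemma pow_rpow_inv_rpow {r κ : ℝ} (hr : 1 < r) (hκ : 0 ≤ κ) (n : ℕ) :
    ((κ ^ (1 / (r - 1))) ^ n) ^ (r - 1) = κ ^ n := by
  have hr1 : 0 < r - 1 := by linarith
  rw [← Real.rpow_natCast, ← Real.rpow_mul hκ, ← Real.rpow_mul hκ]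
  rw [show 1 / (r - 1) * n * (r - 1) = (n : ℝ) by field_simp, Real.rpow_natCast]

lemma le_two_rpow_sub_one {r : ℝ} (hr : 2 ≤ r) : r ≤ (2 : ℝ) ^ (r - 1) := by
  have := one_add_mul_self_le_rpow_one_add (by norm_num : (-1 : ℝ) ≤ 1) (by linarith : 1 ≤ r - 1)
  norm_num at this
  linarith

lemma mul_self_sub_one_le_two_rpow {r : ℝ} (hr : 2 ≤ r) :
    0.701 * (r * (r - 1)) ≤ (2 : ℝ) ^ r := by
  rcases le_total r 4 with h4 | h4
  · have h := one_add_mul_self_le_rpow_one_add (by norm_num : (-1 : ℝ) ≤ 1)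
      (by linarith : 1 ≤ r / 2)
    have e : (2 : ℝ) ^ r = ((1 + 1 : ℝ) ^ (r / 2)) ^ 2 := by
      rw [← Real.rpow_mul_natCast (by norm_num)]; norm_num
    rw [e]
    refine le_trans ?_ (pow_le_pow_left₀ (by linarith) h 2)
    nlinarith
  · have h := one_add_mul_self_le_rpow_one_add (by norm_num : (-1 : ℝ) ≤ 1)
      (by linarith : 1 ≤ r / 3)
    have e : (2 : ℝ) ^ r = ((1 + 1 : ℝ) ^ (r / 3)) ^ 3 := by
      rw [← Real.rpow_mul_natCast (by norm_num)]; norm_num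
    rw [e]
    refine le_trans ?_ (pow_le_pow_left₀ (by linarith) h 3)
    nlinarith [mul_nonneg (by linarith : 0 ≤ r) (sq_nonneg (r - 5))]

lemma mul_le_rpow_of_le_mul_pow {a x c : ℝ} {n : ℕ} (hn : 0 < n) (ha : -1 ≤ a) (hx : n ≤ x)
    (hpos : 0 ≤ 1 + a * (x / n)) (h : c ≤ (1 + a * (x / n)) ^ n) : c ≤ (1 + a) ^ x := by
  have hn0 : (0 : ℝ) < n := by exact_mod_cast hn
  have hb := one_add_mul_self_le_rpow_one_add ha (by rwa [le_div_iff₀ hn0, one_mul] : 1 ≤ x / n)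
  have e : (1 + a) ^ x = ((1 + a) ^ (x / n)) ^ n := by
    rw [← Real.rpow_mul_natCast (by linarith), div_mul_cancel₀ _ hn0.ne']
  rw [e]
  rw [mul_comm] at hpos h
  exact h.trans (pow_le_pow_left₀ hpos hb n)

lemma transient_constants_small {r : ℝ} (hr : 2 ≤ r) (hr6 : r ≤ 6) :
    0.605 * r ≤ (1.42 : ℝ) ^ (r - 1) ∧ 0.6454 * r ≤ (1.53 : ℝ) ^ (r - 1) ∧
      r / 16 ≤ (0.95 : ℝ) ^ (r - 1) := by
  have e1 : (1.42 : ℝ) = 1 + 0.42 := by norm_num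
  have e2 : (1.53 : ℝ) = 1 + 0.53 := by norm_num
  have e3 : (0.95 : ℝ) = 1 + -0.05 := by norm_num
  rw [e1, e2, e3]
  refine ⟨?_, ?_, ?_⟩
  · rcases le_total r 3 with h | h
    · exact mul_le_rpow_of_le_mul_pow (n := 1) (by norm_num) (by norm_num) (by norm_num; linarith)
        (by norm_num; linarith) (by norm_num; linarith)
    · exact mul_le_rpow_of_le_mul_pow (n := 2) (by norm_num) (by norm_num) (by norm_num; linarith)
        (by norm_num; linarith) (by norm_num; nlinarith)
  · rcases le_total r 3 with h | h
    · exact mul_le_rpow_of_le_mul_pow (n := 1) (by norm_num) (by norm_num) (by norm_num; linarith)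
        (by norm_num; linarith) (by norm_num; linarith)
    · exact mul_le_rpow_of_le_mul_pow (n := 2) (by norm_num) (by norm_num) (by norm_num; linarith)
        (by norm_num; linarith) (by norm_num; nlinarith)
  · exact mul_le_rpow_of_le_mul_pow (n := 1) (by norm_num) (by norm_num) (by norm_num; linarith)
      (by norm_num; linarith) (by norm_num; linarith)

lemma transient_constants_large {r : ℝ} (hr : 6 ≤ r) :
    0.605 * r ≤ (1.3 : ℝ) ^ (r - 1) ∧ 0.6454 * r ≤ (1.33 : ℝ) ^ (r - 1) ∧
      r / 16 ≤ (1.035 : ℝ) ^ (r - 1) := by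
  have e1 : (1.3 : ℝ) = 1 + 0.3 := by norm_num
  have e2 : (1.33 : ℝ) = 1 + 0.33 := by norm_num
  have e3 : (1.035 : ℝ) = 1 + 0.035 := by norm_num
  rw [e1, e2, e3]
  refine ⟨?_, ?_, ?_⟩
  · refine mul_le_rpow_of_le_mul_pow (n := 5) (by norm_num) (by norm_num) (by norm_num; linarith)
      (by norm_num; linarith) ?_
    have h := one_add_mul_le_pow (a := 0.06 * (r - 6) / 1.3)
      ((by norm_num : (-2 : ℝ) ≤ 0).trans (by apply div_nonneg <;> linarith)) 5
    have e : 1 + 0.3 * ((r - 1) / (5 : ℕ)) = 1.3 * (1 + 0.06 * (r - 6) / 1.3) := by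
      norm_num; ring
    rw [e, mul_pow]
    norm_num at h ⊢
    linarith
  · refine mul_le_rpow_of_le_mul_pow (n := 5) (by norm_num) (by norm_num) (by norm_num; linarith)
      (by norm_num; linarith) ?_
    have h := one_add_mul_le_pow (a := 0.066 * (r - 6) / 1.33)
      ((by norm_num : (-2 : ℝ) ≤ 0).trans (by apply div_nonneg <;> linarith)) 5
    have e : 1 + 0.33 * ((r - 1) / (5 : ℕ)) = 1.33 * (1 + 0.066 * (r - 6) / 1.33) := by
      norm_num; ring
    rw [e, mul_pow]
    norm_num at h ⊢
    linarith
  · exact mul_le_rpow_of_le_mul_pow (n := 2) (by norm_num) (by norm_num) (by norm_num; linarith)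
      (by norm_num; linarith) (by norm_num; nlinarith [sq_nonneg (r - 46)])

/-- The extra cost of the mixed potential in Young's inequality is small relative to the noise. -/
lemma young_excess_le {r G h H : ℝ} (hr : 2 ≤ r) (hG : 0 ≤ G) (hh : 0 ≤ h) (hH : 64 * h ≤ H) :
    (r - 1) / r * (5 / 4 * (h * G ^ (r - 1))) ^ (1 / (r - 1))
      ≤ (r - 1) / r * (h * G ^ (r - 1)) ^ (1 / (r - 1)) + 0.03 * G * H ^ (1 / (r - 1)) := by
  have hr1 : 0 < r - 1 := by linarith
  have hr0 : 0 < r := by linarith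
  set s := 1 / (r - 1) with hs
  have hs0 : 0 < s := by positivity
  have hs1 : s ≤ 1 := by rw [hs, div_le_one hr1]; linarith
  have hGs : (G ^ (r - 1)) ^ s = G := by
    rw [← Real.rpow_mul hG, hs, mul_one_div_cancel hr1.ne', Real.rpow_one]
  have h1 : (5 / 4 : ℝ) ^ s ≤ 1 + s * (1 / 4) := by
    have := rpow_one_add_le_one_add_mul_self (by norm_num : (-1 : ℝ) ≤ 1 / 4) hs0.le hs1
    norm_num at this ⊢
    exact this
  have h2 : 25 / 3 * s ≤ (64 : ℝ) ^ s := by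
    have hlog : 4.158 ≤ Real.log 64 := by
      rw [show (64 : ℝ) = 2 ^ 6 by norm_num, Real.log_pow]
      have := Real.log_two_gt_d9
      norm_num at this ⊢
      linarith
    rw [Real.rpow_def_of_pos (by norm_num)]
    refine le_trans ?_ (Real.quadratic_le_exp_of_nonneg (by positivity))
    have h3 : 4.158 * s ≤ Real.log 64 * s := mul_le_mul_of_nonneg_right hlog hs0.le
    have h4 : (4.158 * s) ^ 2 ≤ (Real.log 64 * s) ^ 2 := pow_le_pow_left₀ (by positivity) h3 2
    nlinarith [sq_nonneg (s - 0.25)]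
  have h3 : (64 : ℝ) ^ s * h ^ s ≤ H ^ s := by
    rw [← Real.mul_rpow (by norm_num) hh]
    exact Real.rpow_le_rpow (by positivity) hH hs0.le
  rw [Real.mul_rpow (by norm_num) (by positivity), Real.mul_rpow hh (by positivity), hGs]
  have hhs : 0 ≤ h ^ s := by positivity
  have h4 : ((5 / 4 : ℝ) ^ s - 1) * h ^ s ≤ 0.03 * H ^ s := by
    have h5 : 25 / 3 * s * h ^ s ≤ H ^ s := (mul_le_mul_of_nonneg_right h2 hhs).trans h3
    have h6 := mul_le_mul_of_nonneg_right h1 hhs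
    linarith
  have h5 : (r - 1) / r ≤ 1 := by rw [div_le_one hr0]; linarith
  have h6 : 0 ≤ ((5 / 4 : ℝ) ^ s - 1) * h ^ s * G := by
    have := Real.one_le_rpow (by norm_num : (1 : ℝ) ≤ 5 / 4) hs0.le
    exact mul_nonneg (mul_nonneg (by linarith) hhs) hG
  have h7 := mul_le_mul_of_nonneg_right h4 hG
  have h8 := mul_le_mul_of_nonneg_right h5 h6
  linarith

end RealBounds

section Averaging

/-- The consensus term of the convergence bound at time `t`, in normalized form. -/
noncomputable def consensusTerm (r c Z N κ : ℝ) (t : ℕ) : ℝ :=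
  (c * (κ ^ t * Z + N)) ^ (1 / (r - 1))

/-- The bound on the distance of the agents from their average at time `t`. -/
noncomputable def consensusError (r c Z N κ : ℝ) (t : ℕ) : ℝ :=
  (r / 2 * (c * (1.21 * κ ^ (8 * t) * Z + N / 8))) ^ (1 / (r - 1))

variable {r c Z N κ : ℝ}

lemma consensusTerm_pos (hc : 0 < c) (hZ : 0 ≤ Z) (hN : 0 < N) (hκ : 0 < κ) (t : ℕ) :
    0 < consensusTerm r c Z N κ t := by
  unfold consensusTerm; positivity

lemma noise_le_consensusTerm (hr : 2 ≤ r) (hc : 0 < c) (hZ : 0 ≤ Z) (hN : 0 < N) (hκ : 0 < κ)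
    (t : ℕ) : (c * N) ^ (1 / (r - 1)) ≤ consensusTerm r c Z N κ t := by
  have : 0 < r - 1 := by linarith
  have hk : 0 ≤ κ ^ t * Z := by positivity
  unfold consensusTerm
  gcongr
  linarith

lemma consensusError_nonneg (hr : 2 ≤ r) (hc : 0 < c) (hZ : 0 ≤ Z) (hN : 0 < N) (hκ : 0 < κ)
    (t : ℕ) : 0 ≤ consensusError r c Z N κ t := by
  have : 0 < r := by linarith
  unfold consensusError; positivity

lemma consensusError_antitone (hr : 2 ≤ r) (hc : 0 < c) (hZ : 0 ≤ Z) (hN : 0 < N) (hκ : 0 < κ)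
    (hκ1 : κ < 1) : Antitone (consensusError r c Z N κ) := by
  intro a b hab
  have : 0 < r := by linarith
  have : 0 < r - 1 := by linarith
  have hp : κ ^ (8 * b) ≤ κ ^ (8 * a) := pow_le_pow_of_le_one hκ.le hκ1.le (by omega)
  unfold consensusError
  gcongr

lemma rate_mul_consensusTerm_le (hr : 2 ≤ r) (hc : 0 < c) (hZ : 0 ≤ Z) (hN : 0 < N) (hκ : 0 < κ)
    (hκ1 : κ < 1) (t : ℕ) :
    κ ^ (1 / (r - 1)) * consensusTerm r c Z N κ t ≤ consensusTerm r c Z N κ (t + 1) := by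
  have : 0 < r - 1 := by linarith
  unfold consensusTerm
  rw [← Real.mul_rpow hκ.le (by positivity), pow_succ]
  refine Real.rpow_le_rpow (by positivity) ?_ (by positivity)
  have h1 : κ * N ≤ N := mul_le_of_le_one_left hN.le hκ1.le
  have h2 := mul_le_mul_of_nonneg_left h1 hc.le
  linarith

lemma consensusError_le (hr : 2 ≤ r) (hc : 0 < c) (hZ : 0 ≤ Z) (hN : 0 < N) (hκ : 0 < κ)
    {A M : ℝ} (hA0 : 0 ≤ A) (hA : 0.605 * r ≤ A ^ (r - 1)) (hM : r / 16 ≤ M ^ (r - 1))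
    (hM0 : 0 ≤ M) (t : ℕ) :
    consensusError r c Z N κ t
      ≤ max (A * (κ ^ (1 / (r - 1))) ^ (7 * t)) M * consensusTerm r c Z N κ t := by
  have hr0 : 0 < r := by linarith
  have hr1 : 0 < r - 1 := by linarith
  unfold consensusError consensusTerm
  refine rpow_inv_le_mul (r := r) (by linarith) (by positivity) (le_max_of_le_right hM0) (by positivity) ?_
  set X := max (A * (κ ^ (1 / (r - 1))) ^ (7 * t)) M
  have h1 : 0.605 * r * κ ^ (7 * t) ≤ X ^ (r - 1) := by
    refine le_trans ?_ (Real.rpow_le_rpow (by positivity) (le_max_left _ _) hr1.le)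
    rw [Real.mul_rpow hA0 (by positivity), pow_rpow_inv_rpow (by linarith) hκ.le]
    gcongr
  have h2 : r / 16 ≤ X ^ (r - 1) :=
    hM.trans (Real.rpow_le_rpow hM0 (le_max_right _ _) hr1.le)
  have h3 := mul_le_mul_of_nonneg_right h1 (by positivity : 0 ≤ c * (κ ^ t * Z))
  have h4 := mul_le_mul_of_nonneg_right h2 (by positivity : 0 ≤ c * N)
  have e : κ ^ (8 * t) = κ ^ (7 * t) * κ ^ t := by rw [← pow_add]; congr 1; ring
  rw [e]
  linarith

lemma consensusError_le_of_large (hr : 2 ≤ r) (hc : 0 < c) (hZ : 0 ≤ Z) (hN : 0 < N) (hκ : 0 < κ)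
    {A : ℝ} (hA0 : 0 ≤ A) (hA : 0.6454 * r ≤ A ^ (r - 1)) {t : ℕ}
    (ht : 2 * (c * N) ^ (1 / (r - 1)) < consensusError r c Z N κ t) :
    consensusError r c Z N κ t
      ≤ A * (κ ^ (1 / (r - 1))) ^ (7 * t) * consensusTerm r c Z N κ t := by
  have hr0 : 0 < r := by linarith
  have hr1 : 0 < r - 1 := by linarith
  have h1 : 2 * N < 1.21 * κ ^ (8 * t) * Z + N / 8 := by
    by_contra! hle
    refine not_le.2 ht ?_
    refine rpow_inv_le_mul (r := r) (X := 2) (Y := c * N) (by linarith) (by positivity) (by norm_num) (by positivity) ?_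
    have h3 := mul_le_mul_of_nonneg_right (le_two_rpow_sub_one hr) (by positivity : 0 ≤ c * N)
    have h4 := mul_le_mul_of_nonneg_left hle (by positivity : 0 ≤ r / 2 * c)
    linarith
  unfold consensusError consensusTerm
  refine rpow_inv_le_mul (r := r) (by linarith) (by positivity) (by positivity) (by positivity) ?_
  rw [Real.mul_rpow hA0 (by positivity), pow_rpow_inv_rpow (by linarith) hκ.le]
  have e : κ ^ (8 * t) = κ ^ (7 * t) * κ ^ t := by rw [← pow_add]; congr 1; ring
  have h2 := mul_le_mul_of_nonneg_right hA (by positivity : 0 ≤ κ ^ (7 * t) * (c * (κ ^ t * Z)))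
  have h3 : 0 ≤ A ^ (r - 1) * κ ^ (7 * t) * (c * N) := by positivity
  have h4 : r / 2 * c * (1.21 * κ ^ (8 * t) * Z + N / 8)
      ≤ r / 2 * c * (16 / 15 * (1.21 * κ ^ (8 * t) * Z)) :=
    mul_le_mul_of_nonneg_left (by linarith) (by positivity)
  have h5 : 0 ≤ κ ^ (7 * t) * (c * (κ ^ t * Z)) * r := by positivity
  rw [e] at h4 ⊢
  linarith

lemma sum_consensusError_le_aux (hr : 2 ≤ r) (hc : 0 < c) (hZ : 0 ≤ Z) (hN : 0 < N) (hκ : 0 < κ)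
    (hκ1 : κ < 1) {A A' M b q₀ Q : ℝ} (hA : 0.605 * r ≤ A ^ (r - 1))
    (hA' : 0.6454 * r ≤ A' ^ (r - 1)) (hM : r / 16 ≤ M ^ (r - 1)) (hM0 : 0 ≤ M) (hMA : M ≤ A)
    (hA1 : 1 ≤ A) (hAA' : A ≤ A') (hb0 : 0 < b) (hb1 : b ≤ 1) (hMb : 0.915 * M + 0.015 ≤ b)
    (hbb : 0.915 * b + 0.015 ≤ b) (hq₀ : 0 < q₀) (hq : q₀ ≤ κ ^ (1 / (r - 1)))
    (hQ : A' * Q ^ 7 ≤ b * q₀ ^ 7) (hA'b : A' * 0.285 ^ 7 ≤ b)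
    (hfin : A - 1 + (1 - b) * 0.285 ≤ Q * (A - b)) {k n : ℕ}
    (hn : (κ ^ (1 / (r - 1))) ^ n ≤ 0.285) (hkn : k ≤ n)
    (hk : ∀ t < k, 2 * (c * N) ^ (1 / (r - 1)) < consensusError r c Z N κ t) :
    ∑ t ∈ Finset.range k, consensusError r c Z N κ t
      + ∑ t ∈ Finset.Ico k n, (0.915 * consensusError r c Z N κ t
          + 0.015 * consensusTerm r c Z N κ t)
      ≤ ∑ t ∈ Finset.range n, consensusTerm r c Z N κ t := by
  have hr1 : 0 < r - 1 := by linarith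
  set q := κ ^ (1 / (r - 1)) with hqdef
  have hq0 : 0 < q := by positivity
  have hq1 : q < 1 := Real.rpow_lt_one hκ.le hκ1 (by positivity)
  set L := consensusTerm r c Z N κ with hLdef
  set ε := consensusError r c Z N κ with hεdef
  have hL0 : ∀ t, 0 < L t := consensusTerm_pos hc hZ hN hκ
  have hratio : ∀ t, ε t / L t ≤ max (A * q ^ (7 * t)) M := fun t => by
    rw [div_le_iff₀ (hL0 t)]
    exact consensusError_le hr hc hZ hN hκ (by linarith) hA hM hM0 t
  have hlarge : ∀ t < k, ε t / L t ≤ A' * q ^ (7 * t) := fun t ht => by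
    rw [div_le_iff₀ (hL0 t)]
    exact consensusError_le_of_large hr hc hZ hN hκ (by linarith) hA' (hk t ht)
  have hex : ∃ j : ℕ, A' * q ^ (7 * j) ≤ b := by
    refine ⟨n, le_trans ?_ hA'b⟩
    rw [mul_comm 7 n, pow_mul]
    have := pow_le_pow_left₀ (by positivity) hn 7
    exact mul_le_mul_of_nonneg_left this (by linarith)
  classical
  set k₂ := Nat.find hex with hk₂
  have hk₂spec : A' * q ^ (7 * k₂) ≤ b := Nat.find_spec hex
  have hk₂n : k₂ ≤ n := by
    refine Nat.find_min' hex (le_trans ?_ hA'b)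
    rw [mul_comm 7 n, pow_mul]
    have := pow_le_pow_left₀ (by positivity) hn 7
    exact mul_le_mul_of_nonneg_left this (by linarith)
  have hQk : Q ≤ q ^ k₂ := by
    rcases Nat.eq_zero_or_pos k₂ with h0 | hpos
    · rw [h0, pow_zero]
      by_contra! hlt
      have : A - b < Q * (A - b) ∨ A - b = 0 := by
        rcases (sub_nonneg.2 (hb1.trans hA1)).eq_or_lt with h | h
        · right; exact h.symm
        · left; exact lt_mul_of_one_lt_left h hlt
      have h7 : (1 : ℝ) ≤ Q ^ 7 := one_le_pow₀ hlt.le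
      have h8 : q₀ ^ 7 < 1 := pow_lt_one₀ hq₀.le (hq.trans_lt hq1) (by norm_num)
      nlinarith
    · obtain ⟨j, hj⟩ : ∃ j, k₂ = j + 1 := ⟨k₂ - 1, by omega⟩
      have hmin : b < A' * q ^ (7 * j) := not_le.1 (Nat.find_min hex (by omega : j < k₂))
      by_contra! hlt
      rw [hj, pow_succ] at hlt
      have h1 : q ^ j * q₀ ≤ Q :=
        (mul_le_mul_of_nonneg_left hq (by positivity)).trans hlt.le
      have h2 := pow_le_pow_left₀ (by positivity) h1 7
      rw [mul_pow, ← pow_mul, mul_comm j 7] at h2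
      have h3 := mul_le_mul_of_nonneg_left h2 (by linarith : 0 ≤ A')
      have h4 := mul_lt_mul_of_pos_right hmin (by positivity : 0 < q₀ ^ 7)
      linarith
  set ω : ℕ → ℝ := fun t => if t < k then ε t / L t else 0.915 * (ε t / L t) + 0.015 with hω
  have hpow : ∀ t, q ^ (7 * t) ≤ 1 := fun t => pow_le_one₀ hq0.le hq1.le
  have key := sum_weight_sub_one_mul_nonpos (L := L) (ω := ω) (A := A) (b := b) hq0 hq1
    (fun t => (hL0 t).le) (rate_mul_consensusTerm_le hr hc hZ hN hκ hκ1) hA1 hb1 hk₂n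
    (fun t _ => by
      have h1 : ε t / L t ≤ A := (hratio t).trans
        (max_le (mul_le_of_le_one_right (by linarith) (hpow t)) hMA)
      simp only [hω]
      split_ifs
      · exact h1
      · linarith)
    (fun t ht _ => by
      have hq7 : q ^ (7 * t) ≤ q ^ (7 * k₂) := pow_le_pow_of_le_one hq0.le hq1.le (by omega)
      have h2 : A' * q ^ (7 * t) ≤ b :=
        (mul_le_mul_of_nonneg_left hq7 (by linarith)).trans hk₂spec
      simp only [hω]
      split_ifs with htk
      · exact (hlarge t htk).trans h2
      · have h3 : A * q ^ (7 * t) ≤ b :=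
          (mul_le_mul_of_nonneg_right hAA' (by positivity)).trans h2
        rcases le_max_iff.1 (hratio t) with h | h <;> linarith)
    (by
      have h1 := mul_le_mul_of_nonneg_right hQk (by linarith : 0 ≤ A - b)
      have h2 := mul_le_mul_of_nonneg_left hn (by linarith : 0 ≤ 1 - b)
      linarith)
  have hsplit : ∑ t ∈ Finset.range n, (ω t - 1) * L t
      = ∑ t ∈ Finset.range k, ε t + ∑ t ∈ Finset.Ico k n, (0.915 * ε t + 0.015 * L t)
        - ∑ t ∈ Finset.range n, L t := by
    simp only [sub_mul, one_mul, Finset.sum_sub_distrib]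
    congr 1
    rw [← Finset.sum_range_add_sum_Ico _ hkn]
    congr 1
    · refine Finset.sum_congr rfl fun t ht => ?_
      simp only [hω, if_pos (Finset.mem_range.1 ht)]
      exact div_mul_cancel₀ _ (hL0 t).ne'
    · refine Finset.sum_congr rfl fun t ht => ?_
      simp only [hω, if_neg (not_lt.2 (Finset.mem_Ico.1 ht).1)]
      rw [add_mul, mul_assoc, div_mul_cancel₀ _ (hL0 t).ne']
  linarith

lemma sum_consensusError_le (hr : 2 ≤ r) (hc : 0 < c) (hZ : 0 ≤ Z) (hN : 0 < N)
    (hκ : 31 / 32 ≤ κ) (hκ1 : κ < 1) {k n : ℕ} (hn : (κ ^ (1 / (r - 1))) ^ n ≤ 0.285) (hkn : k ≤ n)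
    (hk : ∀ t < k, 2 * (c * N) ^ (1 / (r - 1)) < consensusError r c Z N κ t) :
    ∑ t ∈ Finset.range k, consensusError r c Z N κ t
      + ∑ t ∈ Finset.Ico k n, (0.915 * consensusError r c Z N κ t
          + 0.015 * consensusTerm r c Z N κ t)
      ≤ ∑ t ∈ Finset.range n, consensusTerm r c Z N κ t := by
  have hr1 : 0 < r - 1 := by linarith
  have hκ0 : 0 < κ := by linarith
  rcases le_total r 6 with h6 | h6
  · obtain ⟨hA, hA', hM⟩ := transient_constants_small hr h6
    have hq : 31 / 32 ≤ κ ^ (1 / (r - 1)) := by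
      refine hκ.trans ?_
      have := Real.rpow_le_rpow_of_exponent_ge hκ0 hκ1.le
        (by rw [div_le_one hr1]; linarith : 1 / (r - 1) ≤ 1)
      rwa [Real.rpow_one] at this
    exact sum_consensusError_le_aux hr hc hZ hN hκ0 hκ1 (b := 0.9) (Q := 0.863) hA hA' hM
      (by norm_num) (by norm_num) (by norm_num) (by norm_num) (by norm_num) (by norm_num)
      (by norm_num) (by norm_num) (by norm_num) hq (by norm_num) (by norm_num) (by norm_num) hn hkn hk
  · obtain ⟨hA, hA', hM⟩ := transient_constants_large h6
    have hq : 0.99 ≤ κ ^ (1 / (r - 1)) := by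
      have h1 : κ ^ (1 / 5 : ℝ) ≤ κ ^ (1 / (r - 1)) :=
        Real.rpow_le_rpow_of_exponent_ge hκ0 hκ1.le
          (one_div_le_one_div_of_le (by norm_num) (by linarith))
      refine le_trans ?_ h1
      rw [one_div, Real.le_rpow_inv_iff_of_pos (by norm_num) hκ0.le (by norm_num)]
      refine le_trans ?_ hκ
      norm_num
    exact sum_consensusError_le_aux hr hc hZ hN hκ0 hκ1 (b := 0.97) (Q := 0.9351) hA hA' hM
      (by norm_num) (by norm_num) (by norm_num) (by norm_num) (by norm_num) (by norm_num)
      (by norm_num) (by norm_num) (by norm_num) hq (by norm_num) (by norm_num) (by norm_num) hn hkn hk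

end Averaging

lemma sum_Ico_le_of_telescoping {a b e : ℕ → ℝ} (h : ∀ t, a t ≤ b t + (e (t + 1) - e t)) {k n : ℕ}
    (hkn : k ≤ n) : ∑ t ∈ Finset.Ico k n, a t ≤ ∑ t ∈ Finset.Ico k n, b t + (e n - e k) := by
  induction n, hkn using Nat.le_induction with
  | base => simp
  | succ n hkn ih =>
    rw [Finset.sum_Ico_succ_top hkn, Finset.sum_Ico_succ_top hkn]
    linarith [h n]

/-- At a point far from the minimizer the Bregman divergence dominates linear terms. -/
lemma mul_le_uniform_convexity {r σ η c N x ρ : ℝ} (hr : 2 ≤ r) (hσ : 0 < σ) (hη : 0 < η)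
    (hc : 1 ≤ c * σ) (hN : 0 ≤ N) (hx : (c * N) ^ (1 / (r - 1)) ≤ x) (hρ : 2 * x ≤ ρ) :
    ρ * (2 ^ (r - 1) / r * (N / η)) ≤ σ / r * ρ ^ r / η := by
  have hr0 : 0 < r := by linarith
  have hr1 : 0 < r - 1 := by linarith
  have hc0 : 0 < c := pos_of_mul_pos_left (by linarith) hσ.le
  have hx0 : 0 ≤ x := le_trans (by positivity) hx
  have hρ0 : 0 ≤ ρ := by linarith
  have h1 : c * N ≤ x ^ (r - 1) := by
    have := Real.rpow_le_rpow (by positivity) hx hr1.le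
    rwa [← Real.rpow_mul (by positivity), one_div_mul_cancel hr1.ne', Real.rpow_one] at this
  have h2 : 2 ^ (r - 1) * x ^ (r - 1) ≤ ρ ^ (r - 1) := by
    rw [← Real.mul_rpow (by norm_num) hx0]
    exact Real.rpow_le_rpow (by positivity) hρ hr1.le
  have h3 : ρ ^ r = ρ * ρ ^ (r - 1) := by
    rcases hρ0.eq_or_lt with h | h
    · rw [← h, Real.zero_rpow hr0.ne', zero_mul]
    · rw [Real.rpow_sub_one h.ne']; field_simp
  have h4 : 2 ^ (r - 1) * N ≤ σ * ρ ^ (r - 1) := by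
    have e1 := mul_le_mul_of_nonneg_left h1 (by positivity : (0 : ℝ) ≤ 2 ^ (r - 1))
    have e2 := mul_le_mul_of_nonneg_left (e1.trans h2) hσ.le
    have e3 := mul_le_mul_of_nonneg_right hc (by positivity : (0 : ℝ) ≤ 2 ^ (r - 1) * N)
    linarith
  have h5 := mul_le_mul_of_nonneg_left h4 (by positivity : 0 ≤ ρ / (r * η))
  rw [h3]
  calc ρ * (2 ^ (r - 1) / r * (N / η)) = ρ / (r * η) * (2 ^ (r - 1) * N) := by field_simp
    _ ≤ ρ / (r * η) * (σ * ρ ^ (r - 1)) := h5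
    _ = σ / r * (ρ * ρ ^ (r - 1)) / η := by field_simp

lemma consensusError_le_consensusTerm {r c Z N κ : ℝ} (hr : 2 ≤ r) (hc : 0 < c) (hZ : 0 ≤ Z)
    (hN : 0 < N) (hκ : 0 < κ) (hκ1 : κ < 1) (t : ℕ) :
    consensusError r c Z N κ t ≤ 1.42 * consensusTerm r c Z N κ t := by
  have hr1 : 0 < r - 1 := by linarith
  have hq : (κ ^ (1 / (r - 1))) ^ (7 * t) ≤ 1 :=
    pow_le_one₀ (by positivity) (Real.rpow_le_one hκ.le hκ1.le (by positivity))
  have hL := (consensusTerm_pos (r := r) hc hZ hN hκ t).le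
  rcases le_total r 6 with h6 | h6
  · obtain ⟨hA, -, hM⟩ := transient_constants_small hr h6
    refine (consensusError_le hr hc hZ hN hκ (by norm_num) hA hM (by norm_num) t).trans
      (mul_le_mul_of_nonneg_right (max_le ?_ (by norm_num)) hL)
    linarith
  · obtain ⟨hA, -, hM⟩ := transient_constants_large h6
    refine (consensusError_le hr hc hZ hN hκ (by norm_num) hA hM (by norm_num) t).trans
      (mul_le_mul_of_nonneg_right (max_le ?_ (by norm_num)) hL)
    linarith

/-- Over a horizon of several mixing times, the transient decays by a constant factor. -/
lemma rate_pow_le {r κ : ℝ} (hr : 2 ≤ r) (hκ : 31 / 32 ≤ κ) (hκ1 : κ < 1) {n : ℕ}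
    (hn : 1.6 * (r - 1) ≤ (n + 1) * (1 - κ)) : (κ ^ (1 / (r - 1))) ^ n ≤ 0.285 := by
  have hκ0 : 0 < κ := by linarith
  have hr1 : 0 < r - 1 := by linarith
  set q := κ ^ (1 / (r - 1)) with hq
  have hq0 : 0 < q := by positivity
  have hq1 : 31 / 32 ≤ q := by
    refine hκ.trans ?_
    have := Real.rpow_le_rpow_of_exponent_ge hκ0 hκ1.le
      (by rw [div_le_one hr1]; linarith : 1 / (r - 1) ≤ 1)
    rwa [Real.rpow_one] at this
  have h1 : q ^ (n + 1) ≤ Real.exp (-1.6) := by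
    have e : q ^ (n + 1) = Real.exp (Real.log κ * ((n + 1) / (r - 1))) := by
      rw [← Real.rpow_natCast, hq, ← Real.rpow_mul hκ0.le, Real.rpow_def_of_pos hκ0]
      congr 2
      push_cast
      ring
    rw [e, Real.exp_le_exp]
    have hlog := Real.log_le_sub_one_of_pos hκ0
    have h2 := mul_le_mul_of_nonneg_right hlog (by positivity : 0 ≤ ((n : ℝ) + 1) / (r - 1))
    refine h2.trans ?_
    rw [mul_div_assoc', div_le_iff₀ hr1]
    linarith
  have h2 : Real.exp (-1.6) * 3.88 ≤ 1 := by
    have h3 := Real.quadratic_le_exp_of_nonneg (x := 1.6) (by norm_num)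
    have h4 : Real.exp (-1.6) * Real.exp 1.6 = 1 := by rw [← Real.exp_add]; norm_num
    have h5 := Real.exp_pos (-1.6)
    nlinarith
  rw [pow_succ] at h1
  have h3 : 0 ≤ q ^ n := by positivity
  nlinarith

set_option maxHeartbeats 600000 in
/-- The two potential inequalities force one of the first `T` gaps below the average bound. -/
lemma exists_gap_le {r σ η G c Z N κ : ℝ} (hr : 2 ≤ r) (hσ : 0 < σ) (hη : 0 < η) (hG : 0 < G)
    (hc : 1 ≤ c * σ) (hZ : 0 ≤ Z) (hNκ : 2 * (η * G) ≤ N * (1 - κ)) (hκ : 31 / 32 ≤ κ) (hκ1 : κ < 1)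
    {δ D J A ρ : ℕ → ℝ} {a : ℝ} {T : ℕ} (hT : 1 ≤ T)
    (hmirror : ∀ t, δ t + (D (t + 1) - D t) / η ≤ 2 * G * consensusError r c Z N κ t
      + (r - 1) / r * (η * G ^ r / σ) ^ (1 / (r - 1)))
    (hmixed : ∀ t, δ t ≤ (4 / 5 * (D t - D (t + 1)) + 1 / 5 * (J t - J (t + 1))) / η
      + 1 / 2 * (A (t + 1) - A t) + G * (1.83 * consensusError r c Z N κ t)
      + (r - 1) / r * (5 / 4 * (η * G ^ r / σ)) ^ (1 / (r - 1)))
    (hDJ : ∀ t, D t ≤ J t) (hJD : ∀ t, J t - D t ≤ 2 * σ / r * consensusError r c Z N κ t ^ r)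
    (hA : ∀ t, |A t - a - δ t| ≤ G * consensusError r c Z N κ t) (hδ : ∀ t, 0 ≤ δ t)
    (hδρ : ∀ t, δ t ≤ G * ρ t) (hρ : ∀ t, 0 ≤ ρ t) (hD : ∀ t, σ / r * ρ t ^ r ≤ D t) :
    ∃ t < T, δ t ≤ 2 * G / T * ∑ t ∈ Finset.range T, consensusTerm r c Z N κ t
      + (r - 1) / r * (η * G ^ r / σ) ^ (1 / (r - 1)) + D 0 / (η * T) := by
  have hr0 : 0 < r := by linarith
  have hr1 : 0 < r - 1 := by linarith
  have hκ0 : 0 < κ := by linarith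
  have hc0 : 0 < c := pos_of_mul_pos_left (by linarith) hσ.le
  have hηG : 0 < η * G := by positivity
  have hN : 0 < N := pos_of_mul_pos_left (by linarith) (by linarith : 0 ≤ 1 - κ)
  have hN64 : 64 * (η * G) ≤ N := by nlinarith
  have hL0 : ∀ t, 0 < consensusTerm r c Z N κ t := consensusTerm_pos hc0 hZ hN hκ0
  have hLN : ∀ t, (c * N) ^ (1 / (r - 1)) ≤ consensusTerm r c Z N κ t :=
    noise_le_consensusTerm hr hc0 hZ hN hκ0
  have hεL : ∀ t, consensusError r c Z N κ t ≤ 1.42 * consensusTerm r c Z N κ t :=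
    consensusError_le_consensusTerm hr hc0 hZ hN hκ0 hκ1
  have hε0 : ∀ t, 0 ≤ consensusError r c Z N κ t := consensusError_nonneg hr hc0 hZ hN hκ0
  have hanti := consensusError_antitone hr hc0 hZ hN hκ0 hκ1
  have hsum := @sum_consensusError_le r c Z N κ hr hc0 hZ hN hκ hκ1
  generalize consensusTerm r c Z N κ = L at *
  generalize consensusError r c Z N κ = ε at *
  set S := (r - 1) / r * (η * G ^ r / σ) ^ (1 / (r - 1)) with hS
  have hS0 : 0 ≤ S := by positivity
  have hD0 : 0 ≤ D 0 := le_trans (mul_nonneg (by positivity) (Real.rpow_nonneg (hρ 0) _)) (hD 0)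
  obtain ⟨n, rfl⟩ : ∃ n, T = n + 1 := ⟨T - 1, by omega⟩
  have hT0 : (0 : ℝ) < ((n + 1 : ℕ) : ℝ) := by positivity
  by_contra! hcon
  set Lbar := (∑ t ∈ Finset.range (n + 1), L t) / ((n + 1 : ℕ) : ℝ) with hLbar
  have hLsum : ∑ t ∈ Finset.range (n + 1), L t = ((n + 1 : ℕ) : ℝ) * Lbar := by
    rw [hLbar]; field_simp
  have hgap : ∀ t < n + 1, 2 * G * Lbar + S + D 0 / (η * ((n + 1 : ℕ) : ℝ)) < δ t := by
    intro t ht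
    have := hcon t ht
    rw [hLsum] at this
    rwa [show 2 * G / ((n + 1 : ℕ) : ℝ) * (((n + 1 : ℕ) : ℝ) * Lbar) = 2 * G * Lbar by field_simp]
      at this
  have hxL : (c * N) ^ (1 / (r - 1)) ≤ Lbar := by
    rw [hLbar, le_div_iff₀ hT0]
    have := Finset.card_nsmul_le_sum (Finset.range (n + 1)) L _ fun t _ => hLN t
    rw [Finset.card_range, nsmul_eq_mul] at this
    linarith
  have hx0 : 0 < (c * N) ^ (1 / (r - 1)) := by positivity
  have hLbar0 : 0 < Lbar := hx0.trans_le hxL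
  have hρL : 2 * Lbar ≤ ρ n := by
    have h1 := (hgap n (by omega)).trans_le (hδρ n)
    have h2 : 0 ≤ D 0 / (η * ((n + 1 : ℕ) : ℝ)) := by positivity
    have h3 : G * (2 * Lbar) ≤ G * ρ n := by linarith
    exact le_of_mul_le_mul_left h3 hG
  have hbonus := mul_le_uniform_convexity hr hσ hη hc hN.le hxL hρL
  set b := σ / r * ρ n ^ r / η with hb
  have hbD : b ≤ D n / η := div_le_div_of_nonneg_right (hD n) hη.le
  have hb64 : 64 * (G * ρ n) ≤ b := by
    refine le_trans ?_ hbonus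
    have h1 : 1 ≤ (2 : ℝ) ^ (r - 1) / r := by
      rw [le_div_iff₀ hr0, one_mul]; exact le_two_rpow_sub_one hr
    have h2 : 64 * G ≤ N / η := by rw [le_div_iff₀ hη]; linarith
    have h3 : 64 * G ≤ 2 ^ (r - 1) / r * (N / η) := by nlinarith
    have h4 := mul_le_mul_of_nonneg_left h3 (hρ n)
    linarith
  have htotal : 2 * G * ∑ t ∈ Finset.range (n + 1), L t + ((n : ℝ) + 1) * S + D 0 / η
      < ∑ t ∈ Finset.range (n + 1), δ t := by
    have h1 := Finset.sum_lt_sum_of_nonempty (s := Finset.range (n + 1)) (by simp)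
      fun t ht => hgap t (Finset.mem_range.1 ht)
    rw [Finset.sum_const, Finset.card_range, nsmul_eq_mul] at h1
    rw [hLsum]
    have e : D 0 / (η * ((n + 1 : ℕ) : ℝ)) = D 0 / η / ((n + 1 : ℕ) : ℝ) := by field_simp
    have e2 : ((n + 1 : ℕ) : ℝ) * (D 0 / η / ((n + 1 : ℕ) : ℝ)) = D 0 / η := by field_simp
    rw [e, mul_add, mul_add, e2] at h1
    push_cast at h1 ⊢
    linarith
  have hstatic : ∀ k, ∑ t ∈ Finset.range k, δ t
      ≤ 2 * G * ∑ t ∈ Finset.range k, ε t + k * S + (D 0 - D k) / η := by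
    intro k
    have h1 := sum_Ico_le_of_telescoping (a := δ) (b := fun t => 2 * G * ε t + S)
      (e := fun t => - (D t / η)) (fun t => by
        have := hmirror t
        rw [sub_div] at this
        linarith) (Nat.zero_le k)
    simp only [← Finset.range_eq_Ico, Finset.sum_add_distrib, Finset.sum_const, Finset.card_range,
      nsmul_eq_mul, ← Finset.mul_sum] at h1
    rw [sub_div]
    linarith
  have hlast : δ n ≤ G * ρ n := hδρ n
  have hLn : ∑ t ∈ Finset.range n, L t ≤ ∑ t ∈ Finset.range (n + 1), L t := by
    rw [Finset.sum_range_succ]; linarith [hL0 n]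
  have hrate : (κ ^ (1 / (r - 1))) ^ n ≤ 0.285 := by
    refine rate_pow_le hr hκ hκ1 ?_
    have h1 := hstatic n
    rw [Finset.sum_range_succ δ] at htotal
    have h2 : ∑ t ∈ Finset.range n, ε t ≤ 1.42 * ∑ t ∈ Finset.range (n + 1), L t := by
      refine le_trans ?_ (mul_le_mul_of_nonneg_left hLn (by norm_num))
      rw [Finset.mul_sum]
      exact Finset.sum_le_sum fun t _ => hεL t
    have h3 := mul_le_mul_of_nonneg_left h2 (by positivity : 0 ≤ 2 * G)
    rw [sub_div] at h1
    have h4 : 63 / 64 * b ≤ 0.84 * G * ∑ t ∈ Finset.range (n + 1), L t := by linarith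
    rw [hLsum] at h4
    have h5 : 2 * G / (1 - κ) ≤ N / η := by
      rw [div_le_div_iff₀ (by linarith) hη]; linarith
    have h6 : 2 * Lbar * (2 ^ (r - 1) / r * (2 * G / (1 - κ))) ≤ b := by
      refine le_trans ?_ hbonus
      exact mul_le_mul hρL (mul_le_mul_of_nonneg_left h5 (by positivity))
        (mul_nonneg (by positivity) (div_nonneg (by positivity) (by linarith))) (hρ n)
    have h7 : 0.701 * (r - 1) ≤ 2 ^ r / r := by
      rw [le_div_iff₀ hr0]
      linarith [mul_self_sub_one_le_two_rpow hr]
    have h8 : (2 : ℝ) ^ (r - 1) / r = 2 ^ r / r / 2 := by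
      rw [Real.rpow_sub_one (by norm_num)]; ring
    have hk : 0 < 1 - κ := by linarith
    have h9 : 2 * (G * Lbar) * (0.701 * (r - 1)) / (1 - κ) ≤ b := by
      refine le_trans ?_ h6
      rw [h8, show 2 * Lbar * (2 ^ r / r / 2 * (2 * G / (1 - κ)))
        = 2 * (G * Lbar) * (2 ^ r / r) / (1 - κ) by ring]
      gcongr
    rw [div_le_iff₀ hk] at h9
    have h10 : 0 < G * Lbar := by positivity
    push_cast at h4
    have h11 : G * Lbar * (1.6 * (r - 1)) ≤ G * Lbar * (((n : ℝ) + 1) * (1 - κ)) := by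
      have h12 := mul_le_mul_of_nonneg_right h4 hk.le
      nlinarith
    exact le_of_mul_le_mul_left h11 h10
  have hex : ∃ k, k = n ∨ ε k ≤ 2 * Lbar := ⟨n, Or.inl rfl⟩
  classical
  obtain ⟨k, hkn, hk, hbefore⟩ : ∃ k ≤ n, (k = n ∨ ε k ≤ 2 * Lbar) ∧ ∀ t < k, 2 * Lbar < ε t := by
    refine ⟨Nat.find hex, Nat.find_min' hex (Or.inl rfl), Nat.find_spec hex, fun t ht => ?_⟩
    have := Nat.find_min hex ht
    push Not at this
    exact this.2
  have hweights := hsum hrate hkn fun t ht => by linarith [hbefore t ht]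
  have hexcess : (r - 1) / r * (5 / 4 * (η * G ^ r / σ)) ^ (1 / (r - 1))
      ≤ S + 0.03 * G * (c * N) ^ (1 / (r - 1)) := by
    have h1 := young_excess_le (r := r) (G := G) (h := η * G / σ) (H := c * N) hr hG.le
      (by positivity) (by
        rw [mul_div_assoc', div_le_iff₀ hσ]
        nlinarith)
    have e : η * G / σ * G ^ (r - 1) = η * G ^ r / σ := by
      rw [Real.rpow_sub_one hG.ne']; field_simp
    rwa [e] at h1
  have hlater : ∑ t ∈ Finset.Ico k n, δ t
      ≤ 2 * G * ∑ t ∈ Finset.Ico k n, (0.915 * ε t + 0.015 * L t) + (n - k) * S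
        + ((4 / 5 * (D k - D n) + 1 / 5 * (J k - J n)) / η + 1 / 2 * (A n - A k)) := by
    have h1 := sum_Ico_le_of_telescoping (a := δ)
      (b := fun t => 2 * G * (0.915 * ε t + 0.015 * L t) + S)
      (e := fun t => - ((4 / 5 * D t + 1 / 5 * J t) / η) + 1 / 2 * A t) (fun t => by
        have h2 := hmixed t
        have h3 := mul_le_mul_of_nonneg_left (hLN t) (by positivity : 0 ≤ 0.03 * G)
        rw [show (4 / 5 * (D t - D (t + 1)) + 1 / 5 * (J t - J (t + 1))) / η
          = (4 / 5 * D t + 1 / 5 * J t) / η - (4 / 5 * D (t + 1) + 1 / 5 * J (t + 1)) / η by ring]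
          at h2
        linarith) hkn
    rw [Finset.sum_add_distrib, Finset.sum_const, Nat.card_Ico, nsmul_eq_mul, ← Finset.mul_sum,
      Nat.cast_sub hkn] at h1
    refine h1.trans (le_of_eq ?_)
    ring
  have hend : (D 0 - D k) / η + ((4 / 5 * (D k - D n) + 1 / 5 * (J k - J n)) / η
      + 1 / 2 * (A n - A k)) ≤ D 0 / η - 0.6 * b + 1.5 * (G * ρ n) := by
    rcases hk with rfl | hk
    · have h1 : 0 ≤ G * ρ k := mul_nonneg hG.le (hρ k)
      simp only [sub_self, mul_zero, add_zero, zero_div, sub_div]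
      linarith
    · have hερ : ε k ≤ ρ n := hk.trans hρL
      have h1 : 1 / 5 * (J k - D k) / η ≤ 0.4 * b := by
        have h2 := Real.rpow_le_rpow (hε0 k) hερ hr0.le
        have h3 : J k - D k ≤ 2 * σ / r * ρ n ^ r :=
          (hJD k).trans (mul_le_mul_of_nonneg_left h2 (by positivity))
        rw [hb, div_le_iff₀ hη]
        have e : 0.4 * (σ / r * ρ n ^ r / η) * η = 1 / 5 * (2 * σ / r * ρ n ^ r) := by
          field_simp; ring
        rw [e]
        linarith
      have h2 : 0 ≤ (J n - D n) / η := div_nonneg (by linarith [hDJ n]) hη.le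
      have h3 : A n - A k ≤ 3 * (G * ρ n) := by
        have e1 := abs_le.1 (hA n)
        have e2 := abs_le.1 (hA k)
        have e3 := mul_le_mul_of_nonneg_left ((hanti hkn).trans hερ) hG.le
        have e4 := mul_le_mul_of_nonneg_left hερ hG.le
        linarith [hδ k]
      have e : (D 0 - D k) / η + ((4 / 5 * (D k - D n) + 1 / 5 * (J k - J n)) / η)
          = D 0 / η + 1 / 5 * (J k - D k) / η - 1 / 5 * ((J n - D n) / η) - D n / η := by ring
      linarith
  rw [Finset.sum_range_succ δ, ← Finset.sum_range_add_sum_Ico δ hkn] at htotal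
  have h1 := hstatic k
  have h2 := mul_le_mul_of_nonneg_left hweights (by positivity : 0 ≤ 2 * G)
  have h3 := mul_le_mul_of_nonneg_left hLn (by positivity : 0 ≤ 2 * G)
  have h4 : 0 < G * ρ n := mul_pos hG (by linarith)
  linarith

section Descent

variable {V : Type*} [NormedAddCommGroup V] [InnerProductSpace ℝ V] [CompleteSpace V]

lemma ConvexOn.add_inner_gradient_le {f : V → ℝ} (hf : ConvexOn ℝ Set.univ f) {x : V}
    (hd : DifferentiableAt ℝ f x) (y : V) : f x + ⟪gradient f x, y - x⟫ ≤ f y := by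
  have hline : ConvexOn ℝ Set.univ (f ∘ AffineMap.lineMap (k := ℝ) x y) := by
    simpa using hf.comp_affineMap (AffineMap.lineMap (k := ℝ) x y)
  have h0 : HasFDerivAt f (fderiv ℝ f x) (AffineMap.lineMap (k := ℝ) x y 0) := by
    simpa using hd.hasFDerivAt
  have hder := h0.comp_hasDerivAt (0 : ℝ) AffineMap.hasDerivAt_lineMap
  have h := hline.le_slope_of_hasDerivAt (Set.mem_univ 0) (Set.mem_univ 1) zero_lt_one hder
  rw [inner_gradient_left, map_sub]
  simp [slope_def_field] at h
  linarith

lemma norm_gradient_le {f : V → ℝ} {G : ℝ} (hG : 0 ≤ G)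
    (hf : ∀ x y, |f x - f y| ≤ G * ‖x - y‖) (x : V) : ‖gradient f x‖ ≤ G := by
  rw [gradient, LinearIsometryEquiv.norm_map]
  exact norm_fderiv_le_of_lip' ℝ hG (Filter.Eventually.of_forall fun y => hf y x)

end Descent

lemma diag_le_half {m B : ℕ} (hm : 2 ≤ m) {P : ℕ → Matrix (Fin m) (Fin m) ℝ} {ζ : ℝ}
    (hnonneg : ∀ t, ∀ i j, 0 ≤ P t i j) (hrow : ∀ t, ∀ i, ∑ j, P t i j = 1)
    (hdiag : ∀ t, ∀ i, ζ ≤ P t i i)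
    (hedge : ∀ t, ∀ i j : Fin m, i ≠ j → (0 < P t i j ∨ 0 < P t j i) → ζ ≤ P t i j)
    (hconn : ∀ k : ℕ, ∀ i j : Fin m,
      Relation.ReflTransGen
        (fun a b => a ≠ b ∧ ∃ t, k * B ≤ t ∧ t < (k + 1) * B ∧
          (0 < P t a b ∨ 0 < P t b a)) i j) : ζ ≤ 1 / 2 := by
  obtain h | ⟨b, ⟨hne, t, -, -, hpos⟩, -⟩ :=
    (hconn 0 ⟨0, by omega⟩ ⟨1, by omega⟩).cases_head
  · simp at h
  · have h1 := Finset.add_le_sum (fun j _ => hnonneg t ⟨0, by omega⟩ j) (Finset.mem_univ _)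
      (Finset.mem_univ _) hne
    rw [hrow] at h1
    linarith [hdiag t ⟨0, by omega⟩, hedge t _ _ hne hpos]

section Consensus

variable {V : Type*} [NormedAddCommGroup V] [InnerProductSpace ℝ V] {φ : V → ℝ} {g : V → V}
  {σ r ϑ Z N κ : ℝ} {t : ℕ}

lemma norm_sub_le_consensusError (hσ : 0 < σ) (hr : 2 ≤ r)
    (hUC : ∀ x y, φ y + ⟪g y, x - y⟫ + σ / r * ‖x - y‖ ^ r ≤ φ x) {x y : V}
    (h : ‖g x - g y‖ ≤ ϑ * (1.21 * κ ^ (8 * t) * Z + N / 8)) :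
    ‖x - y‖ ≤ consensusError r (ϑ / σ) Z N κ t := by
  have hr0 : 0 < r := by linarith
  refine (norm_sub_le_of_norm_grad_sub_le (by positivity) (by linarith) hUC h).trans (le_of_eq ?_)
  rw [consensusError]
  congr 1
  field_simp

lemma bregman_le_consensusError (hσ : 0 < σ) (hr : 2 ≤ r)
    (hUC : ∀ x y, φ y + ⟪g y, x - y⟫ + σ / r * ‖x - y‖ ^ r ≤ φ x) {x y : V}
    (h : ‖g x - g y‖ ≤ ϑ * (1.21 * κ ^ (8 * t) * Z + N / 8)) :
    bregman φ g x y ≤ 2 * σ / r * consensusError r (ϑ / σ) Z N κ t ^ r := by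
  have hr0 : 0 < r := by linarith
  have hr1 : 0 < r - 1 := by linarith
  set a := ϑ * (1.21 * κ ^ (8 * t) * Z + N / 8) with ha
  have ha0 : 0 ≤ a := (norm_nonneg _).trans h
  have h1 := bregman_add_bregman_swap (φ := φ) (g := g) x y
  have h2 := bregman_nonneg (c := σ / r) (by positivity) hUC y x
  have h3 := (real_inner_le_norm (g x - g y) (x - y)).trans (mul_le_mul h
    (norm_sub_le_consensusError hσ hr hUC h) (norm_nonneg _) ha0)
  have e : consensusError r (ϑ / σ) Z N κ t = (r / (2 * σ) * a) ^ (1 / (r - 1)) := by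
    rw [consensusError, ha]
    congr 1
    field_simp
  have e2 : 2 * σ / r * ((r / (2 * σ) * a) ^ (1 / (r - 1))) ^ r
      = a * (r / (2 * σ) * a) ^ (1 / (r - 1)) := by
    rcases ha0.eq_or_lt with h0 | h0
    · rw [← h0, mul_zero, zero_mul, Real.zero_rpow (by positivity), Real.zero_rpow hr0.ne',
        mul_zero]
    · have hb : 0 < r / (2 * σ) * a := by positivity
      rw [← Real.rpow_mul hb.le, show 1 / (r - 1) * r = 1 + 1 / (r - 1) by field_simp; ring,
        Real.rpow_add hb, Real.rpow_one]
      field_simp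
  rw [e] at h3 ⊢
  linarith

end Consensus

/-- **Theorem 1, Convergence Behavior of AIMS.**
Let `φ : ℝ^d → ℝ` be differentiable and `(σ,r)`-uniformly convex, the local losses
`f i` convex, differentiable, and `G_l`-Lipschitz, `x*` a minimizer of
`F(w) = ∑ i, f i w`, and let the doubly stochastic matrices `P t` satisfy the
connectivity assumption with constants `ζ > 0` and `B ≥ 1`; put
`ϑ = (1 − ζ/(4m²))⁻²`, `κ = (1 − ζ/(4m²))^(1/B)`.  If the AIMS iterates satisfy
`∇φ(y i t) = ∑ j, P t i j • ∇φ(w j t)`,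
`∇φ(w i (t+1)) = ∇φ(y i t) − η • ∇(f i)(w i t)`, and
`∇φ(w̄ t) = (1/m) ∑ i, ∇φ(w i t)`, then for every `T ≥ 1`,
`min_{0 ≤ t < T} F(w̄ t) − F(x*)` is bounded by the sum of a consensus term,
a step-size term, and an initialization term. -/
theorem aims_convergence
    {d m : ℕ} (hm : 1 ≤ m)
    (σ r : ℝ) (hσ : 0 < σ) (hr : 2 ≤ r)
    (φ : EuclideanSpace ℝ (Fin d) → ℝ)
    (hφdiff : Differentiable ℝ φ)
    (hUC : ∀ x y : EuclideanSpace ℝ (Fin d),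
      φ y + ⟪gradient φ y, x - y⟫ + (σ / r) * ‖x - y‖ ^ r ≤ φ x)
    (f : Fin m → EuclideanSpace ℝ (Fin d) → ℝ)
    (hconv : ∀ i, ConvexOn ℝ Set.univ (f i))
    (hfdiff : ∀ i, Differentiable ℝ (f i))
    (G_l : ℝ) (hG : 0 ≤ G_l)
    (hLip : ∀ i, ∀ x y : EuclideanSpace ℝ (Fin d), |f i x - f i y| ≤ G_l * ‖x - y‖)
    (xstar : EuclideanSpace ℝ (Fin d))
    (hxstar : ∀ w : EuclideanSpace ℝ (Fin d), ∑ i, f i xstar ≤ ∑ i, f i w)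
    (P : ℕ → Matrix (Fin m) (Fin m) ℝ)
    (ζ : ℝ) (hζ : 0 < ζ) (B : ℕ) (hB : 1 ≤ B)
    (hnonneg : ∀ t, ∀ i j, 0 ≤ P t i j)
    (hrow : ∀ t, ∀ i, ∑ j, P t i j = 1)
    (hcol : ∀ t, ∀ j, ∑ i, P t i j = 1)
    (hdiag : ∀ t, ∀ i, ζ ≤ P t i i)
    (hedge : ∀ t, ∀ i j : Fin m, i ≠ j →
      (0 < P t i j ∨ 0 < P t j i) → ζ ≤ P t i j)
    (hconn : ∀ k : ℕ, ∀ i j : Fin m,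
      Relation.ReflTransGen
        (fun a b => a ≠ b ∧ ∃ t, k * B ≤ t ∧ t < (k + 1) * B ∧
          (0 < P t a b ∨ 0 < P t b a)) i j)
    (ϑ κ : ℝ)
    (hϑ : ϑ = ((1 - ζ / (4 * (m : ℝ) ^ 2))⁻¹) ^ 2)
    (hκ : κ = (1 - ζ / (4 * (m : ℝ) ^ 2)) ^ ((1 : ℝ) / (B : ℝ)))
    (η : ℝ) (hη : 0 < η)
    (w y : Fin m → ℕ → EuclideanSpace ℝ (Fin d))
    (wbar : ℕ → EuclideanSpace ℝ (Fin d))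
    (hy : ∀ i t, gradient φ (y i t) = ∑ j, P t i j • gradient φ (w j t))
    (hw : ∀ i t, gradient φ (w i (t + 1))
      = gradient φ (y i t) - η • gradient (f i) (w i t))
    (hbar : ∀ t, gradient φ (wbar t) = (1 / (m : ℝ)) • ∑ i, gradient φ (w i t))
    (T : ℕ) (hT : 1 ≤ T) :
    (Finset.range T).inf' (Finset.nonempty_range_iff.mpr (by omega))
        (fun t => ∑ i, f i (wbar t)) - ∑ i, f i xstar
      ≤ (2 * (m : ℝ) * G_l / (T : ℝ)) *
          ∑ t ∈ Finset.range T,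
            ((ϑ / σ) * (κ ^ ((t : ℝ) - 1) * (∑ j, ‖gradient φ (w j 0)‖)
                + (m : ℝ) * η * G_l / (1 - κ) + 2 * η * G_l)) ^ (1 / (r - 1))
        + (m : ℝ) * ((r - 1) / r) * (η * G_l ^ r / σ) ^ (1 / (r - 1))
        + (m : ℝ) * (φ xstar - φ (wbar 0) - ⟪gradient φ (wbar 0), xstar - wbar 0⟫)
            / (η * (T : ℝ)) := by
  have hm0 : (0 : ℝ) < m := by exact_mod_cast hm
  have hm1 : (1 : ℝ) ≤ m := by exact_mod_cast hm
  have hr0 : 0 < r := by linarith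
  have hr1 : 0 < r - 1 := by linarith
  have hT0 : (0 : ℝ) < T := by exact_mod_cast hT
  have hζ1 : ζ ≤ 1 := by
    have h := Finset.single_le_sum (fun j _ => hnonneg 0 ⟨0, hm⟩ j) (Finset.mem_univ ⟨0, hm⟩)
    rw [hrow] at h
    exact (hdiag 0 _).trans h
  set q := 1 - ζ / (4 * (m : ℝ) ^ 2) with hq
  have hq1 : q < 1 := by
    have : 0 < ζ / (4 * (m : ℝ) ^ 2) := by positivity
    linarith
  have hq0 : 0 < q := by
    have : ζ / (4 * (m : ℝ) ^ 2) < 1 := by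
      rw [div_lt_one (by positivity)]
      nlinarith
    linarith
  have hB0 : (0 : ℝ) < B := by exact_mod_cast hB
  have hκ0 : 0 < κ := by rw [hκ]; positivity
  have hκ1 : κ < 1 := by rw [hκ]; exact Real.rpow_lt_one hq0.le hq1 (by positivity)
  have hϑ1 : 1 ≤ ϑ := by rw [hϑ]; exact one_le_pow₀ ((one_le_inv₀ hq0).2 hq1.le)
  have hϑ0 : 0 < ϑ := by linarith
  have hk : 0 < 1 - κ := by linarith
  set g := gradient φ with hg
  set Z := ∑ j, ‖g (w j 0)‖ with hZ
  have hZ0 : 0 ≤ Z := Finset.sum_nonneg fun j _ => norm_nonneg _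
  have hterm : ∀ t : ℕ, consensusTerm r (ϑ / σ) Z (m * (η * G_l) / (1 - κ)) κ t
      ≤ ((ϑ / σ) * (κ ^ ((t : ℝ) - 1) * Z + (m : ℝ) * η * G_l / (1 - κ) + 2 * η * G_l))
        ^ (1 / (r - 1)) := by
    intro t
    refine Real.rpow_le_rpow (by positivity) (mul_le_mul_of_nonneg_left ?_ (by positivity))
      (by positivity)
    have h1 : κ ^ t ≤ κ ^ ((t : ℝ) - 1) := by
      rw [← Real.rpow_natCast]
      exact Real.rpow_le_rpow_of_exponent_ge hκ0 hκ1.le (by linarith)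
    have h2 := mul_le_mul_of_nonneg_right h1 hZ0
    have h3 : 0 ≤ 2 * η * G_l := by positivity
    rw [← mul_assoc]
    linarith
  have hterm0 : 0 ≤ 2 * G_l / T
      * ∑ t ∈ Finset.range T, consensusTerm r (ϑ / σ) Z (m * (η * G_l) / (1 - κ)) κ t :=
    mul_nonneg (by positivity) (Finset.sum_nonneg fun t _ => by unfold consensusTerm; positivity)
  suffices key : ∃ t < T, (∑ i, f i (wbar t) - ∑ i, f i xstar) / m
      ≤ 2 * G_l / T
          * ∑ t ∈ Finset.range T, consensusTerm r (ϑ / σ) Z (m * (η * G_l) / (1 - κ)) κ t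
        + (r - 1) / r * (η * G_l ^ r / σ) ^ (1 / (r - 1))
        + bregman φ g xstar (wbar 0) / (η * T) by
    obtain ⟨t, ht, h⟩ := key
    have h1 := Finset.inf'_le (fun t => ∑ i, f i (wbar t)) (Finset.mem_range.2 ht)
    have h2 := mul_le_mul_of_nonneg_left (Finset.sum_le_sum fun t (_ : t ∈ Finset.range T) =>
      hterm t) (by positivity : 0 ≤ 2 * G_l / T)
    have h3 := mul_le_mul_of_nonneg_left (h.trans (add_le_add_left (add_le_add_left h2 _) _)) hm0.le
    rw [mul_div_cancel₀ _ hm0.ne'] at h3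
    refine (sub_le_sub_right h1 _).trans (h3.trans (le_of_eq ?_))
    simp only [bregman]
    ring
  have hbreg : ∀ x y, 0 ≤ bregman φ g x y := bregman_nonneg (c := σ / r) (by positivity) hUC
  have hgrad : ∀ i x, ‖gradient (f i) x‖ ≤ G_l := fun i => norm_gradient_le hG (hLip i)
  have hfirst : ∀ t i x, f i (w i t) + ⟪gradient (f i) (w i t), x - w i t⟫ ≤ f i x :=
    fun t i => (hconv i).add_inner_gradient_le (hfdiff i _)
  have hstep : ∀ t, g (wbar (t + 1)) = g (wbar t) - (η / m) • ∑ i, gradient (f i) (w i t) := by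
    intro t
    rw [hbar, hbar]
    simp only [hw, hy, Finset.sum_sub_distrib, sum_mix (hcol t), ← Finset.smul_sum, smul_sub,
      smul_smul]
    congr 2
    ring
  have hgap0 : ∀ t, 0 ≤ (∑ i, f i (wbar t) - ∑ i, f i xstar) / m :=
    fun t => div_nonneg (by linarith [hxstar (wbar t)]) hm0.le
  have hgap : ∀ t, (∑ i, f i (wbar t) - ∑ i, f i xstar) / m ≤ G_l * ‖xstar - wbar t‖ := by
    intro t
    rw [div_le_iff₀ hm0, ← Finset.sum_sub_distrib, norm_sub_rev]
    have h := Finset.sum_le_sum fun i (_ : i ∈ Finset.univ) =>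
      (le_abs_self _).trans (hLip i (wbar t) xstar)
    rw [Finset.sum_const, Finset.card_univ, Fintype.card_fin, nsmul_eq_mul] at h
    linarith
  rcases hG.eq_or_lt with hG0 | hG0
  · have h1 := hgap 0
    rw [← hG0, zero_mul] at h1
    have h2 : 0 ≤ (r - 1) / r * (η * G_l ^ r / σ) ^ (1 / (r - 1)) := by positivity
    have h3 : 0 ≤ bregman φ g xstar (wbar 0) / (η * T) := div_nonneg (hbreg _ _) (by positivity)
    exact ⟨0, hT, by linarith⟩
  rcases hm.eq_or_lt with hm2 | hm2
  · have hwbar : ∀ t i, ‖w i t - wbar t‖ ≤ 0 := by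
      intro t i
      subst hm2
      have h : ‖g (w i t) - g (wbar t)‖ ≤ 0 := by
        rw [hbar, Fin.sum_univ_one, Subsingleton.elim i 0]
        simp
      refine (norm_sub_le_of_norm_grad_sub_le (c := σ / r) (by positivity) (by linarith) hUC
        h).trans (le_of_eq ?_)
      rw [zero_div, Real.zero_rpow (by positivity)]
    by_contra! hcon
    have h1 := sum_Ico_le_of_telescoping (e := fun t => - (bregman φ g xstar (wbar t) / η))
      (fun t => by
        have := mean_mirror_step hm hσ hr hη hG hUC hLip (xs := xstar) (fun i => hgrad i (w i t))
          (hfirst t) (hstep t) (hwbar t)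
        rw [sub_div (bregman φ g xstar _), mul_zero, zero_add] at this
        rw [neg_sub_neg]
        linarith : ∀ t, (∑ i, f i (wbar t) - ∑ i, f i xstar) / m
          ≤ (r - 1) / r * (η * G_l ^ r / σ) ^ (1 / (r - 1))
            + (- (bregman φ g xstar (wbar (t + 1)) / η) - - (bregman φ g xstar (wbar t) / η)))
      (Nat.zero_le T)
    have h2 := Finset.sum_lt_sum_of_nonempty (Finset.nonempty_range_iff.2 (by omega : T ≠ 0))
      fun t ht => hcon t (Finset.mem_range.1 ht)
    rw [← Finset.range_eq_Ico, Finset.sum_const, Finset.card_range, nsmul_eq_mul] at h1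
    rw [Finset.sum_const, Finset.card_range, nsmul_eq_mul] at h2
    have h4 : 0 ≤ bregman φ g xstar (wbar T) / η := div_nonneg (hbreg _ _) hη.le
    have e : (T : ℝ) * (bregman φ g xstar (wbar 0) / (η * T)) = bregman φ g xstar (wbar 0) / η := by
      field_simp
    rw [mul_add, mul_add, e] at h2
    have h5 := mul_nonneg hT0.le hterm0
    linarith
  have hm2' : (2 : ℝ) ≤ m := by exact_mod_cast hm2
  have hζ2 := diag_le_half hm2 hnonneg hrow hdiag hedge hconn
  have hqκ : q ≤ κ := by
    have := Real.rpow_le_rpow_of_exponent_ge hq0 hq1.le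
      (by rw [div_le_one hB0]; exact_mod_cast hB : (1 : ℝ) / B ≤ 1)
    rwa [Real.rpow_one, ← hκ] at this
  have hκ31 : 31 / 32 ≤ κ := by
    refine le_trans ?_ hqκ
    have : ζ / (4 * (m : ℝ) ^ 2) ≤ 1 / 32 := by
      rw [div_le_div_iff₀ (by positivity) (by norm_num)]
      nlinarith
    linarith
  have hκB : κ ^ B = q := by
    rw [hκ, ← Real.rpow_natCast, ← Real.rpow_mul hq0.le, one_div_mul_cancel hB0.ne', Real.rpow_one]
  set N := m * (η * G_l) / (1 - κ) with hN
  have hN0 : 0 < N := by positivity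
  have hNκ : 2 * (η * G_l) ≤ N * (1 - κ) := by
    rw [hN, div_mul_cancel₀ _ hk.ne']
    gcongr
  have hdist : ∀ t i, ‖g (w i t) - g (wbar t)‖ ≤ ϑ * (1.21 * κ ^ (8 * t) * Z + N / 8) := by
    intro t i
    rw [hbar, hϑ]
    refine (norm_sub_mean_le_deviation (fun i => g (w i t)) i).trans ?_
    exact deviation_le hm2 hnonneg hrow hcol hζ hζ2 hdiag hedge hB hconn hκ0.le hκ1 hκB
      (z := fun t i => g (w i t)) (v := fun t i => η • gradient (f i) (w i t)) (by positivity)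
      (fun t i => by
        rw [norm_smul, Real.norm_of_nonneg hη.le]
        exact mul_le_mul_of_nonneg_left (hgrad i _) hη.le)
      (fun t i => by rw [hw, hy]) t
  have hε : ∀ t i, ‖w i t - wbar t‖ ≤ consensusError r (ϑ / σ) Z N κ t :=
    fun t i => norm_sub_le_consensusError hσ hr hUC (hdist t i)
  have hanti := consensusError_antitone (r := r) (c := ϑ / σ) (κ := κ) hr (by positivity) hZ0 hN0 hκ0
    hκ1
  have hmove : ∀ t, ‖wbar (t + 1) - wbar t‖ ≤ consensusError r (ϑ / σ) Z N κ t := by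
    intro t
    refine norm_sub_le_consensusError hσ hr hUC ?_
    have h1 : ‖g (wbar (t + 1)) - g (wbar t)‖ ≤ η * G_l := by
      rw [hstep, sub_sub_cancel_left, norm_neg, norm_smul, Real.norm_of_nonneg (by positivity)]
      have h2 := (norm_sum_le Finset.univ fun i => gradient (f i) (w i t)).trans
        (Finset.sum_le_sum fun i _ => hgrad i (w i t))
      rw [Finset.sum_const, Finset.card_univ, Fintype.card_fin, nsmul_eq_mul] at h2
      refine (mul_le_mul_of_nonneg_left h2 (by positivity)).trans (le_of_eq ?_)
      field_simp
    have h2 : 8 * (η * G_l) ≤ N := by nlinarith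
    have h3 : 0 ≤ 1.21 * κ ^ (8 * t) * Z := by positivity
    nlinarith
  have hmean : ∀ t, (∑ i, bregman φ g xstar (w i t)) / m
      = bregman φ g xstar (wbar t) + (∑ i, bregman φ g (wbar t) (w i t)) / m := by
    intro t
    have h := sum_bregman_eq (φ := φ) (g := g) (p := fun _ : Fin m => 1 / (m : ℝ))
      (w := fun i => w i t) (y := wbar t) (by simp [hm0.ne']) (by rw [hbar, Finset.smul_sum]) xstar
    rwa [← Finset.mul_sum, ← Finset.mul_sum, one_div_mul_eq_div, one_div_mul_eq_div] at h
  have hspread : ∀ t, (∑ i, bregman φ g (wbar t) (w i t)) / m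
      ≤ 2 * σ / r * consensusError r (ϑ / σ) Z N κ t ^ r := by
    intro t
    rw [div_le_iff₀ hm0]
    have h := Finset.sum_le_sum fun i (_ : i ∈ Finset.univ) =>
      bregman_le_consensusError (φ := φ) hσ hr hUC
        (by rw [norm_sub_rev]; exact hdist t i : ‖g (wbar t) - g (w i t)‖ ≤ _)
    rw [Finset.sum_const, Finset.card_univ, Fintype.card_fin, nsmul_eq_mul] at h
    linarith
  refine exists_gap_le (c := ϑ / σ) (Z := Z) (N := N) (κ := κ)
    (δ := fun t => (∑ i, f i (wbar t) - ∑ i, f i xstar) / m)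
    (D := fun t => bregman φ g xstar (wbar t)) (J := fun t => (∑ i, bregman φ g xstar (w i t)) / m)
    (A := fun t => (∑ i, f i (w i t)) / m) (a := (∑ i, f i xstar) / m)
    (ρ := fun t => ‖xstar - wbar t‖) hr hσ hη hG0 (by rwa [div_mul_cancel₀ _ hσ.ne']) hZ0 hNκ hκ31
    hκ1 hT (fun t => ?_) (fun t => ?_) (fun t => ?_) (fun t => ?_) (fun t => ?_) hgap0 hgap
    (fun t => norm_nonneg _) (fun t => le_bregman hUC _ _)
  · exact mean_mirror_step hm hσ hr hη hG hUC hLip (fun i => hgrad i (w i t)) (hfirst t) (hstep t)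
      (hε t)
  · have := mixed_potential_step hm hσ hr hη hG hUC hconv hLip (hnonneg t) (hrow t) (hcol t)
      (xs := xstar) (fun i => hgrad i (w i t)) (hfirst t) (fun i => hy i t) (fun i => hw i t)
      (hstep t) (hε t) (fun i => (hε (t + 1) i).trans (hanti t.le_succ)) (hmove t)
    simpa only [sub_div] using this
  · simp only [hmean]
    have : 0 ≤ (∑ i, bregman φ g (wbar t) (w i t)) / m :=
      div_nonneg (Finset.sum_nonneg fun i _ => hbreg _ _) hm0.le
    linarith
  · simp only [hmean]
    linarith [hspread t]
  · rw [← sub_div, ← sub_div, abs_div, abs_of_pos hm0, div_le_iff₀ hm0, sub_sub_sub_cancel_right,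
      ← Finset.sum_sub_distrib]
    refine (Finset.abs_sum_le_sum_abs _ _).trans ?_
    have h := Finset.sum_le_sum fun i (_ : i ∈ Finset.univ) =>
      (hLip i (w i t) (wbar t)).trans (mul_le_mul_of_nonneg_left (hε t i) hG)
    rw [Finset.sum_const, Finset.card_univ, Fintype.card_fin, nsmul_eq_mul] at h
    linarith
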